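/- Let n ≥ 2, α ≥ 1, κ > 0, and let f : B → ℝⁿ \ {0} be a K-quasiregular mapping in the Miniowitz class (Min) with constants C₀, α₀, satisfying the multiplicity condition (M) with exponent 0 ≤ a < n−1 and constant C₁; let f̃ denote its non-tangential limit function (existing σ-a.e.). Suppose μ is an α-Carleson measure on B with constant γ. Then for every 0 < p < ∞: ∫_B |f(x)|^{αp} dμ(x) ≤ C (∫_{S^{n−1}} |f̃(ω)|^p dσ(ω))^α, where C depends only on n, K, a, α₀, C₀, C₁, p, α, κ and the Carleson constant γ. -/

import Mathlib

open MeasureTheory Metric Set Filter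
open scoped ENNReal NNReal Topology Classical

noncomputable section

abbrev Vec (n : ℕ) := EuclideanSpace ℝ (Fin n)

/-- The open unit ball in `ℝⁿ`. -/
def unitBall (n : ℕ) : Set (Vec n) := Metric.ball 0 1

/-- The unit sphere `S^{n-1}` in `ℝⁿ`. -/
def unitSphere (n : ℕ) : Set (Vec n) := Metric.sphere 0 1

/-- Surface measure on the unit sphere, modelled by `(n-1)`-dimensional
Hausdorff measure restricted to the sphere. -/
def sphMeasure (n : ℕ) : Measure (Vec n) := (μH[(n : ℝ) - 1]).restrict (unitSphere n)

/-- `f` is `K`-quasiregular on the unit ball. -/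
def IsQR (n : ℕ) (K : ℝ) (f : Vec n → Vec n) : Prop :=
  ContinuousOn f (unitBall n) ∧
  (∀ x ∈ unitBall n, DifferentiableAt ℝ f x) ∧
  (∀ᵐ x ∂(volume.restrict (unitBall n)),
    ‖fderiv ℝ f x‖ ^ n ≤ K * (fderiv ℝ f x).det)

/-- The conformal automorphism `T_x` of the unit ball (with `T_0 = id`). -/
def mobiusT (n : ℕ) (x : Vec n) (y : Vec n) : Vec n :=
  if x = 0 then y
  else (‖x‖ ^ 2 * ‖y - (‖x‖ ^ 2)⁻¹ • x‖ ^ 2)⁻¹ •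
    ((1 - ‖x‖ ^ 2) • (y - x) - ‖y - x‖ ^ 2 • x)

/-- The Miniowitz class (Min) with constants `C₀, α`. -/
def InMiniowitz (n : ℕ) (C₀ α : ℝ) (f : Vec n → Vec n) : Prop :=
  ∀ x ∈ unitBall n, ∀ y ∈ unitBall n,
    C₀⁻¹ * ((1 - ‖y‖) / (1 + ‖y‖)) ^ α ≤ ‖f (mobiusT n (-x) y)‖ / ‖f (mobiusT n (-x) 0)‖ ∧
    ‖f (mobiusT n (-x) y)‖ / ‖f (mobiusT n (-x) 0)‖ ≤ C₀ * ((1 + ‖y‖) / (1 - ‖y‖)) ^ α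

/-- The multiplicity condition (M) with exponent `a` and constant `C₁`. -/
def MultCond (n : ℕ) (a C₁ : ℝ) (f : Vec n → Vec n) : Prop :=
  ∀ x ∈ unitBall n, ∀ r : ℝ, 0 < r → r < 1 → ∀ y : Vec n,
    (({z ∈ Metric.ball (0 : Vec n) r | f (mobiusT n (-x) z) = y}).encard : ℝ≥0∞) ≤
      ENNReal.ofReal (C₁ / (1 - r) ^ a)

/-- The non-tangential region `Γ(ω)` with aperture parameter `κ`. -/
def ntRegion (n : ℕ) (κ : ℝ) (ω : Vec n) : Set (Vec n) :=
  {x ∈ unitBall n | ‖x - ω‖ < (1 + κ) * (1 - ‖x‖)}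

/-- The non-tangential maximal function `f*`. -/
def ntMax (n : ℕ) (κ : ℝ) (f : Vec n → Vec n) (ω : Vec n) : ℝ≥0∞ :=
  ⨆ x ∈ ntRegion n κ ω, ENNReal.ofReal ‖f x‖

/-- `f` has the non-tangential limit `L` at `ω`. -/
def HasNTLimit (n : ℕ) (κ : ℝ) (f : Vec n → Vec n) (ω L : Vec n) : Prop :=
  Filter.Tendsto f (𝓝[ntRegion n κ ω] ω) (𝓝 L)

/-- The `p`-th mean of `f` on the sphere of radius `r`. -/
def hardyMean (n : ℕ) (p : ℝ) (f : Vec n → Vec n) (r : ℝ) : ℝ≥0∞ :=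
  (sphMeasure n (unitSphere n))⁻¹ *
    ∫⁻ ω, ENNReal.ofReal (‖f (r • ω)‖ ^ p) ∂(sphMeasure n)

/-- The Hardy `H^p` norm of `f` on the unit ball. -/
def hardyNorm (n : ℕ) (p : ℝ) (f : Vec n → Vec n) : ℝ≥0∞ :=
  (⨆ r ∈ Set.Ioo (0 : ℝ) 1, hardyMean n p f r) ^ (1 / p)

/-- `f` belongs to the Hardy space `H^p`. -/
def MemHp (n : ℕ) (p : ℝ) (f : Vec n → Vec n) : Prop := hardyNorm n p f < ⊤

/-- The `L^p(σ)` norm of a boundary function on the unit sphere. -/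
def lpSphere (n : ℕ) (p : ℝ) (g : Vec n → Vec n) : ℝ≥0∞ :=
  (∫⁻ ω, ENNReal.ofReal (‖g ω‖ ^ p) ∂(sphMeasure n)) ^ (1 / p)

/-- The `L^p(σ)` norm of the non-tangential maximal function `f*`. -/
def ntMaxLp (n : ℕ) (κ p : ℝ) (f : Vec n → Vec n) : ℝ≥0∞ :=
  (∫⁻ ω, (ntMax n κ f ω) ^ p ∂(sphMeasure n)) ^ (1 / p)

/-- `μ` is a Carleson measure on the unit ball with constant `c`. -/
def IsCarleson (n : ℕ) (c : ℝ) (μ : Measure (Vec n)) : Prop :=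
  ∀ ω ∈ unitSphere n, ∀ r : ℝ, 0 < r →
    μ (unitBall n ∩ Metric.ball ω r) ≤ ENNReal.ofReal c * ENNReal.ofReal r ^ ((n : ℝ) - 1)

/-- `μ` is an `α`-Carleson measure on the unit ball with constant `γ`. -/
def IsAlphaCarleson (n : ℕ) (α γ : ℝ) (μ : Measure (Vec n)) : Prop :=
  ∀ ω ∈ unitSphere n, ∀ r : ℝ, 0 < r →
    μ (unitBall n ∩ Metric.ball ω r) ≤
      ENNReal.ofReal γ * ENNReal.ofReal r ^ (α * ((n : ℝ) - 1))

/-- The number of pairwise disjoint sets in a sequence that meet a fibre is bounded by the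
cardinality of the fibre. -/
theorem tsum_indicator_image_le_encard {X Y : Type*} (f : X → Y) (s : Set X) (t : ℕ → Set X)
    (ht : Pairwise (Function.onFun Disjoint t)) (y : Y) :
    ∑' k, (f '' (s ∩ t k)).indicator (1 : Y → ℝ≥0∞) y ≤
      (({x ∈ s | f x = y}).encard : ℝ≥0∞) := by
  rcases isEmpty_or_nonempty X with hX | hX
  · simp [Set.eq_empty_of_isEmpty]
  rw [ENNReal.tsum_eq_iSup_sum]
  refine iSup_le fun F => ?_
  have h : ∀ k ∈ F.filter (fun k => y ∈ f '' (s ∩ t k)), ∃ x, x ∈ s ∩ t k ∧ f x = y := by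
    intro k hk
    exact (Finset.mem_filter.1 hk).2
  choose! x hx hxy using h
  have hsum : ∑ k ∈ F, (f '' (s ∩ t k)).indicator (1 : Y → ℝ≥0∞) y =
      ((F.filter (fun k => y ∈ f '' (s ∩ t k))).card : ℝ≥0∞) := by
    rw [Finset.card_filter]
    simp only [Set.indicator_apply, Pi.one_apply, Nat.cast_sum, Nat.cast_ite, Nat.cast_one,
      Nat.cast_zero]
  have hinj : Set.InjOn x ((F.filter (fun k => y ∈ f '' (s ∩ t k)) : Finset ℕ) : Set ℕ) := by
    intro i hi j hj hij
    by_contra hne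
    exact Set.disjoint_left.1 (ht hne) (hx i hi).2 (hij ▸ (hx j hj).2)
  rw [hsum]
  have hsub : x '' ((F.filter (fun k => y ∈ f '' (s ∩ t k)) : Finset ℕ) : Set ℕ) ⊆ {x ∈ s | f x = y} := by
    rintro _ ⟨k, hk, rfl⟩
    exact ⟨(hx k hk).1, hxy k hk⟩
  have h1 := Set.encard_le_encard hsub
  rw [hinj.encard_image, Set.encard_coe_eq_coe_finsetCard] at h1
  calc ((F.filter (fun k => y ∈ f '' (s ∩ t k))).card : ℝ≥0∞)
      = (((F.filter (fun k => y ∈ f '' (s ∩ t k))).card : ℕ∞) : ℝ≥0∞) := by simp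
    _ ≤ _ := ENat.toENNReal_le.2 h1

/-- Change of variables inequality for differentiable maps of bounded multiplicity. -/
theorem lintegral_abs_det_fderiv_mul_le {E : Type*} [NormedAddCommGroup E] [NormedSpace ℝ E]
    [FiniteDimensional ℝ E] [MeasurableSpace E] [BorelSpace E] (μ : Measure E)
    [μ.IsAddHaarMeasure] {f : E → E} {s : Set E} (hs : MeasurableSet s)
    (hf : ∀ x ∈ s, DifferentiableAt ℝ f x) {N : ℝ≥0∞}
    (hN : ∀ y, (({x ∈ s | f x = y}).encard : ℝ≥0∞) ≤ N)
    {h : E → ℝ≥0∞} (hh : Measurable h) :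
    ∫⁻ x in s, ENNReal.ofReal |(fderiv ℝ f x).det| * h (f x) ∂μ ≤
      N * ∫⁻ y in f '' s, h y ∂μ := by
  have hdetm : Measurable fun x => (fderiv ℝ f x).det :=
    ContinuousLinearMap.continuous_det.measurable.comp (measurable_fderiv ℝ f)
  set s' := s ∩ {x | (fderiv ℝ f x).det ≠ 0} with hs'
  have hs'm : MeasurableSet s' :=
    hs.inter (hdetm (measurableSet_singleton 0).compl)
  have hzero : ∫⁻ x in s, ENNReal.ofReal |(fderiv ℝ f x).det| * h (f x) ∂μ =
      ∫⁻ x in s', ENNReal.ofReal |(fderiv ℝ f x).det| * h (f x) ∂μ := by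
    rw [← lintegral_indicator hs, ← lintegral_indicator hs'm]
    refine lintegral_congr fun x => ?_
    by_cases hx : x ∈ s
    · by_cases hd : (fderiv ℝ f x).det = 0
      · simp [hs', Set.indicator_apply, hd]
      · simp [hs', Set.indicator_apply, hd]
    · simp [hs', hx]
  have hder : ∀ x ∈ s', HasFDerivWithinAt f (fderiv ℝ f x) s' x :=
    fun x hx => (hf x hx.1).hasFDerivAt.hasFDerivWithinAt
  -- choose the approximation quality so that `f` is injective on each piece
  have hr : ∀ A : E →L[ℝ] E, ∃ r : ℝ≥0, r ≠ 0 ∧ (A.det ≠ 0 →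
      ∀ u : Set E, ApproximatesLinearOn f A u r → InjOn f u) := by
    intro A
    by_cases hA : A.det = 0
    · exact ⟨1, one_ne_zero, fun h => (h hA).elim⟩
    let B := A.toContinuousLinearEquivOfDetNeZero hA
    have hB : (B : E →L[ℝ] E) = A := by ext; simp [B]
    rcases subsingleton_or_nontrivial E with hE | hE
    · exact ⟨1, one_ne_zero, fun _ u _ => Function.Injective.injOn (fun a b _ => Subsingleton.elim a b)⟩
    · have hpos : 0 < ‖(B.symm : E →L[ℝ] E)‖₊⁻¹ := by
        have := B.nnnorm_symm_pos
        positivity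
      refine ⟨‖(B.symm : E →L[ℝ] E)‖₊⁻¹ / 2, (half_pos hpos).ne', fun _ u hu => ?_⟩
      rw [← hB] at hu
      exact hu.injOn (Or.inr (half_lt_self hpos))
  choose r hr0 hrinj using hr
  obtain ⟨t, A, htd, htm, hst, happ, hA⟩ :=
    exists_partition_approximatesLinearOn_of_hasFDerivWithinAt f s' (fderiv ℝ f) hder r hr0
  have hinj : ∀ k, InjOn f (s' ∩ t k) := by
    intro k
    rcases s'.eq_empty_or_nonempty with he | hne
    · simp [he]
    · obtain ⟨y, hy, hAy⟩ := hA hne k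
      exact hrinj (A k) (hAy ▸ hy.2) _ (happ k)
  have hmeas : ∀ k, MeasurableSet (s' ∩ t k) := fun k => hs'm.inter (htm k)
  have hder' : ∀ k, ∀ x ∈ s' ∩ t k, HasFDerivWithinAt f (fderiv ℝ f x) (s' ∩ t k) x :=
    fun k x hx => (hder x hx.1).mono inter_subset_left
  have himg : ∀ k, MeasurableSet (f '' (s' ∩ t k)) := fun k =>
    measurable_image_of_fderivWithin (hmeas k) (hder' k) (hinj k)
  have hunion : s' = ⋃ k, s' ∩ t k := by
    rw [← inter_iUnion, inter_eq_left.2 hst]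
  have hsup : f '' s' = ⋃ k, f '' (s' ∩ t k) := by
    rw [← image_iUnion, ← hunion]
  have hsupm : MeasurableSet (f '' s') := hsup ▸ MeasurableSet.iUnion himg
  rw [hzero]
  calc ∫⁻ x in s', ENNReal.ofReal |(fderiv ℝ f x).det| * h (f x) ∂μ
      = ∑' k, ∫⁻ x in s' ∩ t k, ENNReal.ofReal |(fderiv ℝ f x).det| * h (f x) ∂μ := by
        conv_lhs => rw [hunion]
        exact lintegral_iUnion hmeas
          (fun i j hij => (htd hij).mono inter_subset_right inter_subset_right) _
    _ = ∑' k, ∫⁻ y in f '' (s' ∩ t k), h y ∂μ := by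
        congr 1; ext k
        exact (lintegral_image_eq_lintegral_abs_det_fderiv_mul μ (hmeas k) (hder' k) (hinj k) h).symm
    _ = ∑' k, ∫⁻ y in f '' s', (f '' (s' ∩ t k)).indicator h y ∂μ := by
        congr 1; ext k
        rw [lintegral_indicator (himg k), Measure.restrict_restrict (himg k),
          inter_eq_left.2 (image_mono inter_subset_left)]
    _ = ∫⁻ y in f '' s', ∑' k, (f '' (s' ∩ t k)).indicator h y ∂μ :=
        (lintegral_tsum fun k => (hh.indicator (himg k)).aemeasurable).symm
    _ ≤ ∫⁻ y in f '' s', N * h y ∂μ := by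
        refine lintegral_mono fun y => ?_
        have : ∀ k, (f '' (s' ∩ t k)).indicator h y =
            (f '' (s' ∩ t k)).indicator (1 : E → ℝ≥0∞) y * h y := by
          intro k; simp [Set.indicator_apply]
        simp only [this]
        rw [ENNReal.tsum_mul_right]
        gcongr
        refine (tsum_indicator_image_le_encard f s' t htd y).trans (le_trans ?_ (hN y))
        exact ENat.toENNReal_le.2 (Set.encard_le_encard fun x hx => ⟨hx.1.1, hx.2⟩)
    _ = N * ∫⁻ y in f '' s', h y ∂μ := lintegral_const_mul _ hh
    _ ≤ N * ∫⁻ y in f '' s, h y ∂μ := by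
        gcongr
        exact inter_subset_left

section Mobius

variable {n : ℕ}

theorem mobiusT_eq {x : Vec n} (hx : x ≠ 0) (y : Vec n) :
    mobiusT n x y = (1 - 2 * inner ℝ x y + ‖x‖ ^ 2 * ‖y‖ ^ 2)⁻¹ •
      ((1 - ‖x‖ ^ 2) • y - (1 - 2 * inner ℝ x y + ‖y‖ ^ 2) • x) := by
  have hx' : ‖x‖ ^ 2 ≠ 0 := by positivity
  have h1 : ‖x‖ ^ 2 * ‖y - (‖x‖ ^ 2)⁻¹ • x‖ ^ 2 = 1 - 2 * inner ℝ x y + ‖x‖ ^ 2 * ‖y‖ ^ 2 := by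
    rw [norm_sub_sq_real, inner_smul_right, norm_smul, real_inner_comm, mul_pow, norm_inv, norm_pow,
      norm_norm]
    field_simp
    ring
  have h2 : ‖y - x‖ ^ 2 = ‖y‖ ^ 2 - 2 * inner ℝ x y + ‖x‖ ^ 2 := by
    rw [norm_sub_sq_real, real_inner_comm]
  rw [mobiusT, if_neg hx, h1, h2]
  congr 1
  module

theorem mobius_denom_pos {x y : Vec n} (hx : ‖x‖ < 1) (hy : ‖y‖ < 1) :
    0 < 1 - 2 * inner ℝ x y + ‖x‖ ^ 2 * ‖y‖ ^ 2 := by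
  have h := real_inner_le_norm x y
  have h1 : ‖x‖ * ‖y‖ < 1 := mul_lt_one_of_nonneg_of_lt_one_left (norm_nonneg _) hx hy.le
  nlinarith [mul_pos (sub_pos.2 h1) (sub_pos.2 h1)]

theorem one_sub_norm_mobiusT_sq {x y : Vec n} (hx0 : x ≠ 0) (hx : ‖x‖ < 1) (hy : ‖y‖ < 1) :
    1 - ‖mobiusT n x y‖ ^ 2 = (1 - ‖x‖ ^ 2) * (1 - ‖y‖ ^ 2) /
      (1 - 2 * inner ℝ x y + ‖x‖ ^ 2 * ‖y‖ ^ 2) := by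
  have hD := mobius_denom_pos hx hy
  rw [mobiusT_eq hx0, norm_smul, mul_pow, norm_sub_sq_real, norm_smul, norm_smul, inner_smul_left,
    inner_smul_right, real_inner_comm x y]
  simp only [mul_pow, norm_inv, Real.norm_eq_abs, inv_pow, sq_abs, conj_trivial]
  field_simp
  ring

theorem norm_mobiusT_lt_one {x y : Vec n} (hx0 : x ≠ 0) (hx : ‖x‖ < 1) (hy : ‖y‖ < 1) :
    ‖mobiusT n x y‖ < 1 := by
  have h := one_sub_norm_mobiusT_sq hx0 hx hy
  have hD := mobius_denom_pos hx hy
  have h2 : 0 < 1 - ‖mobiusT n x y‖ ^ 2 := by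
    rw [h]
    have : 0 < 1 - ‖x‖ ^ 2 := by nlinarith [norm_nonneg x]
    have : 0 < 1 - ‖y‖ ^ 2 := by nlinarith [norm_nonneg y]
    positivity
  nlinarith [norm_nonneg (mobiusT n x y)]

theorem mobiusT_neg_mobiusT {x y : Vec n} (hx0 : x ≠ 0) (hx : ‖x‖ < 1) (hy : ‖y‖ < 1) :
    mobiusT n (-x) (mobiusT n x y) = y := by
  have hD := mobius_denom_pos hx hy
  have hA : 0 < 1 - ‖x‖ ^ 2 := by nlinarith [norm_nonneg x]
  have hz := one_sub_norm_mobiusT_sq hx0 hx hy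
  have hin : inner ℝ x (mobiusT n x y) = (1 - 2 * inner ℝ x y + ‖x‖ ^ 2 * ‖y‖ ^ 2)⁻¹ *
      ((1 - ‖x‖ ^ 2) * inner ℝ x y - (1 - 2 * inner ℝ x y + ‖y‖ ^ 2) * ‖x‖ ^ 2) := by
    rw [mobiusT_eq hx0, inner_smul_right, inner_sub_right, inner_smul_right, inner_smul_right,
      real_inner_self_eq_norm_sq]
  have hz2 : ‖mobiusT n x y‖ ^ 2 = 1 - (1 - ‖x‖ ^ 2) * (1 - ‖y‖ ^ 2) /
      (1 - 2 * inner ℝ x y + ‖x‖ ^ 2 * ‖y‖ ^ 2) := by linarith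
  rw [mobiusT_eq (neg_ne_zero.2 hx0), norm_neg, inner_neg_left, hin, hz2, mobiusT_eq hx0]
  set t := inner ℝ x y
  set s := ‖x‖ ^ 2
  set q := ‖y‖ ^ 2
  set D := 1 - 2 * t + s * q with hDdef
  have hD0 := hD.ne'
  have hA0 := hA.ne'
  have e1 : 1 - 2 * -(D⁻¹ * ((1 - s) * t - (1 - 2 * t + q) * s)) +
      s * (1 - (1 - s) * (1 - q) / D) = (1 - s) ^ 2 / D := by
    field_simp
    rw [hDdef]; ring
  have e2 : 1 - 2 * -(D⁻¹ * ((1 - s) * t - (1 - 2 * t + q) * s)) +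
      (1 - (1 - s) * (1 - q) / D) = (1 - s) * (1 - 2 * t + q) / D := by
    field_simp
    rw [hDdef]; ring
  rw [e1, e2]
  rw [smul_neg, sub_neg_eq_add, smul_smul, smul_sub, smul_smul, smul_smul, sub_add, ← sub_smul,
    smul_sub, smul_smul, smul_smul]
  have e3 : ((1 - s) ^ 2 / D)⁻¹ * ((1 - s) * D⁻¹ * (1 - s)) = 1 := by
    field_simp
  have e4 : (1 - s) * D⁻¹ * (1 - 2 * t + q) - (1 - s) * (1 - 2 * t + q) / D = 0 := by
    field_simp
    ring
  rw [e3, e4]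
  simp

theorem mobiusT_neg_zero {x : Vec n} (hx0 : x ≠ 0) : mobiusT n (-x) 0 = x := by
  rw [mobiusT_eq (neg_ne_zero.2 hx0)]
  simp

/-- Lower bound for the distance of the Möbius image to the sphere. -/
theorem le_one_sub_norm_mobiusT {ω y : Vec n} {δ : ℝ} (hω : ‖ω‖ = 1) (hδ : 0 < δ) (hδ' : δ ≤ 1 / 2)
    (hy : ‖y‖ < 1) (hyω : ‖y - ω‖ ≤ 3 * δ) :
    (1 - ‖y‖) / (32 * δ) ≤ 1 - ‖mobiusT n ((1 - δ) • ω) y‖ := by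
  set x := (1 - δ) • ω with hx
  have hnx : ‖x‖ = 1 - δ := by
    rw [hx, norm_smul, hω, mul_one, Real.norm_of_nonneg (by linarith)]
  have hx1 : ‖x‖ < 1 := by linarith
  have hx0 : x ≠ 0 := by rw [← norm_pos_iff]; linarith
  have hD := mobius_denom_pos hx1 hy
  have h := one_sub_norm_mobiusT_sq hx0 hx1 hy
  have hlt := norm_mobiusT_lt_one hx0 hx1 hy
  have hDeq : 1 - 2 * inner ℝ x y + ‖x‖ ^ 2 * ‖y‖ ^ 2 = ‖(1 - δ) • y - ω‖ ^ 2 := by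
    rw [hnx, norm_sub_sq_real, norm_smul, hω, hx, inner_smul_left, inner_smul_left,
      real_inner_comm, Real.norm_of_nonneg (by linarith)]
    simp only [conj_trivial]
    ring
  have hDle : 1 - 2 * inner ℝ x y + ‖x‖ ^ 2 * ‖y‖ ^ 2 ≤ 16 * δ ^ 2 := by
    rw [hDeq]
    have h1 : ‖(1 - δ) • y - ω‖ ≤ 4 * δ := by
      have : (1 - δ) • y - ω = (y - ω) - δ • y := by module
      rw [this]
      have h2 := norm_sub_le (y - ω) (δ • y)
      rw [norm_smul, Real.norm_of_nonneg hδ.le] at h2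
      nlinarith
    nlinarith [norm_nonneg ((1 - δ) • y - ω)]
  set z := mobiusT n x y
  have h1 : (1 - ‖y‖) / (16 * δ) ≤ 1 - ‖z‖ ^ 2 := by
    rw [h, div_le_div_iff₀ (by positivity) hD, hnx]
    have : 0 ≤ 1 - ‖y‖ := by linarith
    have h3 : (1 - ‖y‖) * (1 - 2 * inner ℝ x y + (1 - δ) ^ 2 * ‖y‖ ^ 2) ≤ (1 - ‖y‖) * (16 * δ ^ 2) := by
      rw [hnx] at hDle
      exact mul_le_mul_of_nonneg_left hDle this
    have h4 : (1 - ‖y‖) * δ ≤ (1 - (1 - δ) ^ 2) * (1 - ‖y‖ ^ 2) := by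
      have e1 : 1 - (1 - δ) ^ 2 = δ * (2 - δ) := by ring
      have e2 : 1 - ‖y‖ ^ 2 = (1 - ‖y‖) * (1 + ‖y‖) := by ring
      rw [e1, e2]
      have : 0 ≤ (1 - ‖y‖) * δ := by positivity
      nlinarith [norm_nonneg y, mul_nonneg this (norm_nonneg y), mul_nonneg (mul_nonneg this (norm_nonneg y)) (by linarith : (0:ℝ) ≤ 1 - δ)]
    nlinarith
  have h2 : 1 - ‖z‖ ^ 2 ≤ 2 * (1 - ‖z‖) := by nlinarith [norm_nonneg z]
  have h3 : (1 - ‖y‖) / (32 * δ) = (1 - ‖y‖) / (16 * δ) / 2 := by field_simp; ring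
  rw [h3]
  linarith

end Mobius

section Sphere

variable {n : ℕ}

/-- The cone measure on the unit sphere. -/
abbrev coneMeasure (n : ℕ) : Measure (sphere (0 : Vec n) 1) := (volume : Measure (Vec n)).toSphere

/-- Integration in polar coordinates. -/
theorem lintegral_eq_lintegral_sphere (hn : 1 ≤ n) {F : Vec n → ℝ≥0∞} (hF : Measurable F) :
    ∫⁻ y, F y = ∫⁻ ω, (∫⁻ t in Ioi (0 : ℝ), ENNReal.ofReal (t ^ (n - 1)) * F (t • (ω : Vec n)))
      ∂(coneMeasure n) := by
  have : Nonempty (Fin n) := ⟨⟨0, hn⟩⟩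
  have hsm : Measurable fun p : sphere (0 : Vec n) 1 × Ioi (0 : ℝ) => F ((p.2 : ℝ) • (p.1 : Vec n)) :=
    hF.comp (by fun_prop)
  have h := (volume : Measure (Vec n)).measurePreserving_homeomorphUnitSphereProd.lintegral_comp_emb
    (Homeomorph.measurableEmbedding _)
    (fun p : sphere (0 : Vec n) 1 × Ioi (0 : ℝ) => F ((p.2 : ℝ) • (p.1 : Vec n)))
  have h1 : ∫⁻ y, F y = ∫⁻ x : ({(0)}ᶜ : Set (Vec n)), F x ∂((volume : Measure (Vec n)).comap (↑)) := by
    rw [lintegral_subtype_comap (measurableSet_singleton _).compl F, restrict_compl_singleton]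
  rw [h1]
  have h2 : ∀ x : ({(0)}ᶜ : Set (Vec n)), F x =
      F (((homeomorphUnitSphereProd (Vec n) x).2 : ℝ) • ((homeomorphUnitSphereProd (Vec n) x).1 : Vec n)) := by
    intro x
    have : ‖(x : Vec n)‖ ≠ 0 := norm_ne_zero_iff.2 x.2
    simp [smul_smul, this]
  simp_rw [h2]
  rw [h, lintegral_prod _ hsm.aemeasurable]
  refine lintegral_congr fun ω => ?_
  have hm : Measurable fun t : Ioi (0 : ℝ) => F ((t : ℝ) • (ω : Vec n)) := hF.comp (by fun_prop)
  rw [Measure.volumeIoiPow, finrank_euclideanSpace_fin]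
  refine (lintegral_withDensity_eq_lintegral_mul _ (by fun_prop) hm).trans ?_
  exact lintegral_subtype_comap measurableSet_Ioi
    (fun t : ℝ => ENNReal.ofReal (t ^ (n - 1)) * F (t • (ω : Vec n)))

theorem lintegral_sphere_Ioo_le (hn : 1 ≤ n) {F : Vec n → ℝ≥0∞} (hF : Measurable F)
    {δ : ℝ} (hδ : δ ≤ 1 / 2) :
    ∫⁻ ω, (∫⁻ t in Ioo (1 - δ) 1, F (t • (ω : Vec n))) ∂(coneMeasure n) ≤
      ENNReal.ofReal (2 ^ (n - 1)) * ∫⁻ y, F y := by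
  rw [lintegral_eq_lintegral_sphere hn hF, ← lintegral_const_mul' _ _ ENNReal.ofReal_ne_top]
  refine lintegral_mono fun ω => ?_
  rw [← lintegral_const_mul' _ _ ENNReal.ofReal_ne_top]
  refine (setLIntegral_mono' measurableSet_Ioo fun t ht => ?_).trans
    (lintegral_mono_set fun t ht => ?_)
  · rw [← mul_assoc, ← ENNReal.ofReal_mul (by positivity), ← mul_pow]
    have : (1 : ℝ) ≤ (2 * t) ^ (n - 1) := one_le_pow₀ (by linarith [ht.1])
    calc F (t • (ω : Vec n)) = ENNReal.ofReal 1 * F (t • (ω : Vec n)) := by simp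
      _ ≤ _ := by gcongr
  · exact lt_trans (by linarith) ht.1

theorem le_coneMeasure_ball (hn : 1 ≤ n) (ω₀ : sphere (0 : Vec n) 1) {δ : ℝ} (hδ : 0 < δ)
    (hδ' : δ ≤ 1 / 2) :
    ENNReal.ofReal ((δ / 16) ^ n) * volume (ball (0 : Vec n) 1) ≤
      ENNReal.ofReal δ * coneMeasure n (ball ω₀ δ) := by
  have : Nonempty (Fin n) := ⟨⟨0, hn⟩⟩
  have hω₀ : ‖(ω₀ : Vec n)‖ = 1 := by simp
  set x : Vec n := (1 - δ / 4) • (ω₀ : Vec n) with hx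
  have hvol : volume (ball x (δ / 16)) = ENNReal.ofReal ((δ / 16) ^ n) * volume (ball (0 : Vec n) 1) := by
    rw [Measure.addHaar_ball_of_pos _ _ (by positivity), finrank_euclideanSpace_fin]
  rw [← hvol, ← lintegral_indicator_one measurableSet_ball,
    lintegral_eq_lintegral_sphere hn (measurable_one.indicator measurableSet_ball),
    ← setLIntegral_const, ← lintegral_indicator measurableSet_ball]
  refine lintegral_mono fun ω => ?_
  have hω : ‖(ω : Vec n)‖ = 1 := by simp
  have key : ∀ t : ℝ, 0 < t → t • (ω : Vec n) ∈ ball x (δ / 16) →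
      t ∈ Ioo (1 - δ) 1 ∧ ω ∈ ball ω₀ δ := by
    intro t ht hmem
    rw [mem_ball, dist_eq_norm] at hmem
    have h1 : |t - (1 - δ / 4)| < δ / 16 := by
      refine lt_of_le_of_lt ?_ hmem
      have := abs_norm_sub_norm_le (t • (ω : Vec n)) x
      rwa [norm_smul, hx, norm_smul, hω, hω₀, mul_one, mul_one, Real.norm_of_nonneg ht.le,
        Real.norm_of_nonneg (by linarith)] at this
    rw [abs_lt] at h1
    refine ⟨⟨by linarith, by linarith⟩, ?_⟩
    rw [mem_ball, Subtype.dist_eq, dist_eq_norm]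
    have h2 : (ω : Vec n) - ω₀ = (1 - t) • (ω : Vec n) + (t • (ω : Vec n) - x) - (δ / 4) • (ω₀ : Vec n) := by
      rw [hx]; module
    rw [h2]
    refine (norm_sub_le _ _).trans_lt ?_
    have h3 := norm_add_le ((1 - t) • (ω : Vec n)) (t • (ω : Vec n) - x)
    rw [norm_smul, hω, mul_one, Real.norm_of_nonneg (by linarith)] at h3
    rw [norm_smul, hω₀, mul_one, Real.norm_of_nonneg (by linarith)]
    linarith
  calc ∫⁻ t in Ioi (0 : ℝ), ENNReal.ofReal (t ^ (n - 1)) *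
        (ball x (δ / 16)).indicator (1 : Vec n → ℝ≥0∞) (t • (ω : Vec n))
      ≤ ∫⁻ t in Ioi (0 : ℝ), (Ioo (1 - δ) 1).indicator
          (fun _ => (ball ω₀ δ).indicator (1 : sphere (0 : Vec n) 1 → ℝ≥0∞) ω) t := by
        refine setLIntegral_mono' measurableSet_Ioi fun t ht => ?_
        by_cases hmem : t • (ω : Vec n) ∈ ball x (δ / 16)
        · obtain ⟨h1, h2⟩ := key t ht hmem
          rw [indicator_of_mem hmem, indicator_of_mem h1, indicator_of_mem h2]
          simp only [Pi.one_apply, mul_one]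
          rw [ENNReal.ofReal_le_one]
          exact pow_le_one₀ (le_of_lt ht) h1.2.le
        · rw [indicator_of_notMem hmem, mul_zero]
          exact zero_le
    _ ≤ ∫⁻ t, (Ioo (1 - δ) 1).indicator
          (fun _ => (ball ω₀ δ).indicator (1 : sphere (0 : Vec n) 1 → ℝ≥0∞) ω) t :=
        setLIntegral_le_lintegral _ _
    _ = (ball ω₀ δ).indicator (fun _ => ENNReal.ofReal δ) ω := by
        rw [lintegral_indicator measurableSet_Ioo, setLIntegral_const, Real.volume_Ioo]
        by_cases hω' : ω ∈ ball ω₀ δ <;> simp [hω', indicator]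

theorem coneMeasure_le_of_ediam_le (hn : 1 ≤ n) {s : Set (sphere (0 : Vec n) 1)}
    (hs : MeasurableSet s) {d : ℝ} (hd : 0 < d) (hd' : d ≤ 1 / 2)
    (hsd : ∀ x ∈ s, ∀ y ∈ s, dist x y ≤ d) :
    coneMeasure n s ≤
      ENNReal.ofReal (2 ^ (n - 1) * 2 ^ n * d ^ (n - 1)) * volume (ball (0 : Vec n) 1) := by
  have : Nonempty (Fin n) := ⟨⟨0, hn⟩⟩
  rcases s.eq_empty_or_nonempty with rfl | ⟨ω₀, hω₀⟩
  · simp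
  have hm : Measurable ((closedBall (ω₀ : Vec n) (2 * d)).indicator (1 : Vec n → ℝ≥0∞)) :=
    measurable_one.indicator measurableSet_closedBall
  have h := lintegral_sphere_Ioo_le hn hm hd'
  rw [lintegral_indicator_one measurableSet_closedBall, Measure.addHaar_closedBall _ _ (by positivity),
    finrank_euclideanSpace_fin] at h
  have h2 : ENNReal.ofReal d * coneMeasure n s ≤
      ∫⁻ ω, (∫⁻ t in Ioo (1 - d) 1, (closedBall (ω₀ : Vec n) (2 * d)).indicator
        (1 : Vec n → ℝ≥0∞) (t • (ω : Vec n))) ∂(coneMeasure n) := by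
    rw [← setLIntegral_const, ← lintegral_indicator hs]
    refine lintegral_mono fun ω => ?_
    by_cases hω : ω ∈ s
    · have hω1 : ‖(ω : Vec n)‖ = 1 := by simp
      rw [indicator_of_mem hω]
      calc ENNReal.ofReal d = ∫⁻ t in Ioo (1 - d) 1, 1 := by simp
        _ ≤ _ := by
          refine setLIntegral_mono' measurableSet_Ioo fun t ht => ?_
          rw [indicator_of_mem]
          · exact le_rfl
          · rw [mem_closedBall, dist_eq_norm]
            have h3 : t • (ω : Vec n) - ω₀ = ((ω : Vec n) - ω₀) - (1 - t) • (ω : Vec n) := by module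
            rw [h3]
            refine (norm_sub_le _ _).trans ?_
            have h4 := hsd ω hω ω₀ hω₀
            rw [Subtype.dist_eq, dist_eq_norm] at h4
            rw [norm_smul, hω1, mul_one, Real.norm_of_nonneg (by linarith [ht.2])]
            linarith [ht.1]
    · rw [indicator_of_notMem hω]
      exact zero_le
  have h3 : ENNReal.ofReal (2 ^ (n - 1)) *
      (ENNReal.ofReal ((2 * d) ^ n) * volume (ball (0 : Vec n) 1)) = ENNReal.ofReal d *
      (ENNReal.ofReal (2 ^ (n - 1) * 2 ^ n * d ^ (n - 1)) * volume (ball (0 : Vec n) 1)) := by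
    rw [← mul_assoc, ← mul_assoc, ← ENNReal.ofReal_mul (by positivity), ← ENNReal.ofReal_mul hd.le]
    congr 2
    obtain ⟨m, rfl⟩ : ∃ m, n = m + 1 := ⟨n - 1, by omega⟩
    simp only [Nat.add_sub_cancel]
    ring
  have h4 := h2.trans h
  rw [h3] at h4
  exact (ENNReal.mul_le_mul_iff_right (by simpa using hd) ENNReal.ofReal_ne_top).1 h4

/-- The cone measure is dominated by the `(n-1)`-dimensional Hausdorff measure. -/
theorem exists_map_coneMeasure_le (hn : 2 ≤ n) :
    ∃ C : ℝ≥0, (coneMeasure n).map (↑) ≤ C • sphMeasure n := by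
  have hn1 : 1 ≤ n := by omega
  have : Nonempty (Fin n) := ⟨⟨0, hn1⟩⟩
  set V := volume (ball (0 : Vec n) 1) with hV
  have hVtop : V ≠ ⊤ := measure_ball_lt_top.ne
  set C : ℝ≥0 := (ENNReal.ofReal (2 ^ (n - 1) * 2 ^ n) * V).toNNReal with hC
  have hCc : (C : ℝ≥0∞) = ENNReal.ofReal (2 ^ (n - 1) * 2 ^ n) * V :=
    ENNReal.coe_toNNReal (ENNReal.mul_ne_top ENNReal.ofReal_ne_top hVtop)
  have hC0 : C ≠ 0 := by
    intro h0
    rw [h0] at hCc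
    have h1 : V ≠ 0 := (measure_ball_pos _ _ one_pos).ne'
    have h2 : ENNReal.ofReal (2 ^ (n - 1) * 2 ^ n : ℝ) ≠ 0 := by
      rw [Ne, ENNReal.ofReal_eq_zero, not_le]; positivity
    exact mul_ne_zero h2 h1 (by simpa using hCc.symm)
  have hemb : MeasurableEmbedding ((↑) : sphere (0 : Vec n) 1 → Vec n) :=
    MeasurableEmbedding.subtype_coe isClosed_sphere.measurableSet
  set M := (coneMeasure n).map ((↑) : sphere (0 : Vec n) 1 → Vec n) with hM
  have bound : ∀ s : Set (Vec n), ∀ d : ℝ, 0 < d → d ≤ 1 / 2 → ediam s ≤ ENNReal.ofReal d →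
      M s ≤ C * ENNReal.ofReal d ^ ((n : ℝ) - 1) := by
    intro s d hd hd' hsd
    calc M s ≤ M (closure s) := measure_mono subset_closure
      _ = coneMeasure n ((↑) ⁻¹' closure s) := hemb.map_apply _ _
      _ ≤ ENNReal.ofReal (2 ^ (n - 1) * 2 ^ n * d ^ (n - 1)) * V := by
        refine coneMeasure_le_of_ediam_le hn1 (hemb.measurable isClosed_closure.measurableSet)
          hd hd' fun x hx y hy => ?_
        have := edist_le_ediam_of_mem (s := closure s) hx hy
        rw [ediam_closure] at this
        have h3 := this.trans hsd
        rw [edist_dist] at h3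
        exact (ENNReal.ofReal_le_ofReal_iff hd.le).1 h3
      _ = C * ENNReal.ofReal d ^ ((n : ℝ) - 1) := by
        have : ((n : ℝ) - 1) = ((n - 1 : ℕ) : ℝ) := by rw [Nat.cast_sub hn1]; simp
        rw [hCc, this, ENNReal.rpow_natCast, ENNReal.ofReal_mul (by positivity),
          ENNReal.ofReal_pow hd.le]
        ring
  have hexp : 0 < (n : ℝ) - 1 := by
    have : (2 : ℝ) ≤ n := by exact_mod_cast hn
    linarith
  have hle : C⁻¹ • M ≤ μH[(n : ℝ) - 1] := by
    refine Measure.le_hausdorffMeasure _ _ (ENNReal.ofReal (1 / 2)) (by simp) fun s hs => ?_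
    have hM' : M s ≤ C * ediam s ^ ((n : ℝ) - 1) := by
      rcases eq_or_ne (ediam s) 0 with h0 | h0
      · rw [h0]
        have hlim : Tendsto (fun d : ℝ => (C : ℝ≥0∞) * ENNReal.ofReal d ^ ((n : ℝ) - 1)) (𝓝[>] 0)
            (𝓝 (C * ENNReal.ofReal 0 ^ ((n : ℝ) - 1))) := by
          refine Tendsto.mono_left ?_ nhdsWithin_le_nhds
          refine ENNReal.Tendsto.const_mul ?_ (Or.inr ENNReal.coe_ne_top)
          exact ((ENNReal.continuous_rpow_const.comp ENNReal.continuous_ofReal).tendsto 0)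
        rw [ENNReal.ofReal_zero] at hlim
        refine ge_of_tendsto hlim ?_
        filter_upwards [Ioo_mem_nhdsGT (show (0 : ℝ) < 1 / 2 by norm_num)] with d hd
        exact bound s d hd.1 hd.2.le (by rw [h0]; exact zero_le)
      · have htop : ediam s ≠ ⊤ := (hs.trans_lt ENNReal.ofReal_lt_top).ne
        have := bound s (ediam s).toReal (ENNReal.toReal_pos h0 htop)
          (ENNReal.toReal_le_of_le_ofReal (by norm_num) hs) (by rw [ENNReal.ofReal_toReal htop])
        rwa [ENNReal.ofReal_toReal htop] at this
    rw [Measure.smul_apply, ENNReal.smul_def, smul_eq_mul, ENNReal.coe_inv hC0]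
    rw [ENNReal.inv_mul_le_iff (by simpa using hC0) ENNReal.coe_ne_top]
    exact hM'
  refine ⟨C, Measure.le_iff.2 fun s hs => ?_⟩
  have h1 : M s = M (s ∩ unitSphere n) := by
    rw [hM, hemb.map_apply, hemb.map_apply]
    congr 1
    ext ω
    simp [unitSphere]
  rw [h1, Measure.smul_apply, sphMeasure, Measure.restrict_apply hs, ENNReal.smul_def, smul_eq_mul]
  have h2 := hle (s ∩ unitSphere n)
  rwa [Measure.smul_apply, ENNReal.smul_def, smul_eq_mul, ENNReal.coe_inv hC0,
    ENNReal.inv_mul_le_iff (by simpa using hC0) ENNReal.coe_ne_top] at h2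

end Sphere

/-- A polynomial bound for the tail of a measure gives a bound for a weighted integral. -/
theorem exists_lintegral_rpow_le {D a b : ℝ} (hD : 0 < D) (hab : a < b) :
    ∃ D' : ℝ, 0 < D' ∧ ∀ {X : Type} [MeasurableSpace X] (m : Measure X) (ρ : X → ℝ),
      Measurable ρ → (∀ᵐ y ∂m, 0 < ρ y ∧ ρ y ≤ 1) →
      (∀ s : ℝ, 0 < s → s < 1 → m {y | s < ρ y} ≤ ENNReal.ofReal (D * s ^ (-a))) → 0 ≤ b →
      ∫⁻ y, ENNReal.ofReal (ρ y ^ b) ∂m ≤ ENNReal.ofReal D' := by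
  set q : ℝ := (1 / 2 : ℝ) ^ (b - a) with hq
  have hq0 : 0 < q := by positivity
  have hq1 : q < 1 := Real.rpow_lt_one (by norm_num) (by norm_num) (by linarith)
  have hterm : ∀ k : ℕ, (((1 / 2 : ℝ) ^ k) ^ b) * (D * ((1 / 2 : ℝ) ^ (k + 1)) ^ (-a)) =
      D * (1 / 2 : ℝ) ^ (-a) * q ^ k := by
    intro k
    have h1 : (((1 / 2 : ℝ) ^ k) ^ b) = ((1 / 2 : ℝ) ^ b) ^ k := by
      rw [← Real.rpow_natCast, ← Real.rpow_natCast, ← Real.rpow_mul (by norm_num),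
        ← Real.rpow_mul (by norm_num), mul_comm]
    have h2 : (((1 / 2 : ℝ) ^ (k + 1)) ^ (-a)) = ((1 / 2 : ℝ) ^ (-a)) ^ (k + 1) := by
      rw [← Real.rpow_natCast, ← Real.rpow_natCast, ← Real.rpow_mul (by norm_num),
        ← Real.rpow_mul (by norm_num), mul_comm]
    have h3 : q = (1 / 2 : ℝ) ^ b * (1 / 2 : ℝ) ^ (-a) := by
      rw [hq, sub_eq_add_neg, Real.rpow_add (by norm_num)]
    rw [h1, h2, h3, mul_pow]
    ring
  have hsum : Summable fun k : ℕ => D * (1 / 2 : ℝ) ^ (-a) * q ^ k :=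
    (summable_geometric_of_lt_one hq0.le hq1).mul_left _
  refine ⟨∑' k : ℕ, D * (1 / 2 : ℝ) ^ (-a) * q ^ k, ?_, ?_⟩
  · exact hsum.tsum_pos (fun k => by positivity) 0 (by positivity)
  intro X _ m ρ hρ hρ01 htail hb
  rw [ENNReal.ofReal_tsum_of_nonneg (fun k => by positivity) hsum]
  have hset : ∀ k : ℕ, MeasurableSet {y | (1 / 2 : ℝ) ^ (k + 1) < ρ y} :=
    fun k => measurableSet_lt measurable_const hρ
  calc ∫⁻ y, ENNReal.ofReal (ρ y ^ b) ∂m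
      ≤ ∫⁻ y, ∑' k : ℕ, {y | (1 / 2 : ℝ) ^ (k + 1) < ρ y}.indicator
          (fun _ => ENNReal.ofReal (((1 / 2 : ℝ) ^ k) ^ b)) y ∂m := by
        refine lintegral_mono_ae ?_
        filter_upwards [hρ01] with y hy
        obtain ⟨k, hk1, hk2⟩ := exists_nat_pow_near_of_lt_one hy.1 hy.2
          (show (0 : ℝ) < 1 / 2 by norm_num) (by norm_num)
        refine le_trans ?_ (ENNReal.le_tsum k)
        rw [indicator_of_mem (by exact hk1)]
        exact ENNReal.ofReal_le_ofReal (Real.rpow_le_rpow hy.1.le hk2 hb)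
    _ = ∑' k : ℕ, ENNReal.ofReal (((1 / 2 : ℝ) ^ k) ^ b) *
          m {y | (1 / 2 : ℝ) ^ (k + 1) < ρ y} := by
        rw [lintegral_tsum fun k => (measurable_const.indicator (hset k)).aemeasurable]
        congr 1; ext k
        rw [lintegral_indicator_const (hset k)]
    _ ≤ ∑' k : ℕ, ENNReal.ofReal (D * (1 / 2 : ℝ) ^ (-a) * q ^ k) := by
        refine ENNReal.tsum_le_tsum fun k => ?_
        rw [← hterm k, ENNReal.ofReal_mul (by positivity)]
        gcongr
        exact htail _ (by positivity) (pow_lt_one₀ (by norm_num) (by norm_num) (by omega))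

theorem lintegral_annulus_le {n : ℕ} (hn : 1 ≤ n) {A B : ℝ} (hA : 0 < A) (hAB : A ≤ B) :
    ∫⁻ y in {y : Vec n | A ≤ ‖y‖ ∧ ‖y‖ ≤ B}, ENNReal.ofReal ((‖y‖ ^ n)⁻¹) ≤
      coneMeasure n univ * ENNReal.ofReal (Real.log (B / A)) := by
  have hset : MeasurableSet {y : Vec n | A ≤ ‖y‖ ∧ ‖y‖ ≤ B} :=
    (measurableSet_le measurable_const measurable_norm).inter
      (measurableSet_le measurable_norm measurable_const)
  have hm : Measurable fun y : Vec n => ENNReal.ofReal ((‖y‖ ^ n)⁻¹) := by fun_prop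
  rw [← lintegral_indicator hset, lintegral_eq_lintegral_sphere hn (hm.indicator hset), mul_comm,
    ← lintegral_const]
  refine lintegral_mono fun ω => ?_
  have hω : ‖(ω : Vec n)‖ = 1 := by simp
  have hI : ∫⁻ t in Icc A B, ENNReal.ofReal (t⁻¹) = ENNReal.ofReal (Real.log (B / A)) := by
    rw [← integral_inv_of_pos hA (hA.trans_le hAB), intervalIntegral.integral_of_le hAB,
      ← integral_Icc_eq_integral_Ioc, ofReal_integral_eq_lintegral_ofReal]
    · refine ContinuousOn.integrableOn_Icc ?_
      exact continuousOn_inv₀.mono fun t ht => (hA.trans_le ht.1).ne'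
    · filter_upwards [ae_restrict_mem measurableSet_Icc] with t ht
      exact inv_nonneg.2 (hA.le.trans ht.1)
  rw [← hI, ← lintegral_indicator measurableSet_Icc]
  refine le_trans (setLIntegral_mono' measurableSet_Ioi fun t (ht : 0 < t) => ?_)
    (setLIntegral_le_lintegral (Ioi 0) _)
  have hnt : ‖t • (ω : Vec n)‖ = t := by rw [norm_smul, hω, mul_one, Real.norm_of_nonneg ht.le]
  by_cases hmem : t ∈ Icc A B
  · rw [indicator_of_mem hmem, indicator_of_mem (by simpa [hnt] using hmem), hnt,
      ← ENNReal.ofReal_mul (by positivity)]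
    refine (congrArg _ ?_).le
    obtain ⟨k, rfl⟩ : ∃ k, n = k + 1 := ⟨n - 1, by omega⟩
    simp only [Nat.add_sub_cancel]
    field_simp
    ring
  · rw [indicator_of_notMem hmem, indicator_of_notMem (by simpa [hnt] using hmem), mul_zero]

theorem measurable_mobiusT (n : ℕ) (x : Vec n) : Measurable (mobiusT n x) := by
  by_cases hx : x = 0
  · have : mobiusT n x = id := by ext y; simp [mobiusT, hx]
    rw [this]; exact measurable_id
  · have : mobiusT n x = fun y => (‖x‖ ^ 2 * ‖y - (‖x‖ ^ 2)⁻¹ • x‖ ^ 2)⁻¹ •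
      ((1 - ‖x‖ ^ 2) • (y - x) - ‖y - x‖ ^ 2 • x) := by ext y; simp [mobiusT, hx]
    rw [this]; fun_prop

theorem InMiniowitz.norm_bounds {n : ℕ} {C₀ α : ℝ} {f : Vec n → Vec n} (hf : InMiniowitz n C₀ α f)
    (hC₀ : 1 ≤ C₀) (hα : 0 < α) (h0 : ∀ x ∈ unitBall n, f x ≠ 0) {x y : Vec n} (hx0 : x ≠ 0)
    (hx : ‖x‖ < 1) (hy : ‖y‖ < 1) {u : ℝ} (hu : 2 / (1 - ‖mobiusT n x y‖) ≤ u) :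
    ‖f x‖ / (C₀ * u ^ α) ≤ ‖f y‖ ∧ ‖f y‖ ≤ ‖f x‖ * (C₀ * u ^ α) := by
  set z := mobiusT n x y with hz
  have hz1 : ‖z‖ < 1 := norm_mobiusT_lt_one hx0 hx hy
  have hxB : x ∈ unitBall n := by simpa [unitBall] using hx
  have hzB : z ∈ unitBall n := by simpa [unitBall] using hz1
  have hzn := norm_nonneg z
  have hz1' : 0 < 1 - ‖z‖ := by linarith
  have hu0 : 0 < u := lt_of_lt_of_le (by positivity) hu
  have h := hf x hxB z hzB
  rw [hz, mobiusT_neg_mobiusT hx0 hx hy, ← hz, mobiusT_neg_zero hx0] at h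
  have hfx : 0 < ‖f x‖ := norm_pos_iff.2 (h0 x hxB)
  have hup : ((1 + ‖z‖) / (1 - ‖z‖)) ^ α ≤ u ^ α := by
    refine Real.rpow_le_rpow (by positivity) (le_trans ?_ hu) hα.le
    gcongr; linarith
  have hlow : (u ^ α)⁻¹ ≤ ((1 - ‖z‖) / (1 + ‖z‖)) ^ α := by
    rw [← Real.inv_rpow hu0.le]
    refine Real.rpow_le_rpow (by positivity) ?_ hα.le
    rw [← inv_div]
    gcongr
    refine le_trans ?_ hu
    gcongr; linarith
  have huα : 0 < u ^ α := by positivity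
  constructor
  · have h1 := h.1
    rw [le_div_iff₀ hfx] at h1
    refine le_trans ?_ h1
    rw [div_eq_mul_inv, mul_comm, mul_inv]
    gcongr
  · have h2 := h.2
    rw [div_le_iff₀ hfx] at h2
    refine h2.trans ?_
    rw [mul_comm]
    gcongr

/-- Energy of `log ‖f‖` in hyperbolic balls. -/
theorem exists_lintegral_energy_le {n : ℕ} (hn : 2 ≤ n) {K C₀ α₀ a a' C₁ : ℝ} (hK : 1 ≤ K)
    (hC₀ : 1 ≤ C₀) (hα₀ : 0 < α₀) (ha0 : 0 ≤ a) (haa' : a < a') (hC₁ : 0 < C₁) :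
    ∃ D : ℝ, 0 < D ∧ ∀ f : Vec n → Vec n, IsQR n K f → (∀ x ∈ unitBall n, f x ≠ 0) →
      InMiniowitz n C₀ α₀ f → MultCond n a C₁ f → ∀ x : Vec n, x ≠ 0 → ‖x‖ < 1 →
      ∀ s : ℝ, 0 < s → s < 1 →
      ∫⁻ y in {y ∈ unitBall n | s < 1 - ‖mobiusT n x y‖},
        ENNReal.ofReal ((‖fderiv ℝ f y‖ / ‖f y‖) ^ n) ≤ ENNReal.ofReal (D * s ^ (-a')) := by
  have hn1 : 1 ≤ n := by omega
  have : Nonempty (Fin n) := ⟨⟨0, hn1⟩⟩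
  set ε := (a' - a) / α₀ with hε
  have hε0 : 0 < ε := div_pos (by linarith) hα₀
  set V := (coneMeasure n univ).toReal with hV
  have hVc : coneMeasure n univ = ENNReal.ofReal V :=
    (ENNReal.ofReal_toReal (measure_ne_top _ _)).symm
  have hV0 : 0 ≤ V := ENNReal.toReal_nonneg
  refine ⟨K * C₁ * V * (2 * (C₀ ^ ε * 2 ^ (a' - a) / ε)) + 1, by positivity, ?_⟩
  intro f hQR h0 hMin hM x hx0 hx s hs0 hs1
  have hfx : 0 < ‖f x‖ := norm_pos_iff.2 (h0 x (by simpa [unitBall] using hx))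
  set S := {y ∈ unitBall n | s < 1 - ‖mobiusT n x y‖} with hS
  have hSm : MeasurableSet S := measurableSet_ball.inter
    (measurableSet_lt measurable_const (measurable_const.sub (measurable_mobiusT n x).norm))
  have hSB : S ⊆ unitBall n := fun y hy => hy.1
  have hh : Measurable fun y : Vec n => ENNReal.ofReal ((‖y‖ ^ n)⁻¹) := by fun_prop
  set u := 2 / s with hu
  have hu2 : 2 ≤ u := by rw [hu, le_div_iff₀ hs0]; linarith
  set R := C₀ * u ^ α₀ with hR
  have hR1 : 1 ≤ R := by
    have : 1 ≤ u ^ α₀ := Real.one_le_rpow (by linarith) hα₀.le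
    nlinarith
  have hann : f '' S ⊆ {y | ‖f x‖ / R ≤ ‖y‖ ∧ ‖y‖ ≤ ‖f x‖ * R} := by
    rintro _ ⟨y, hy, rfl⟩
    have hy1 : ‖y‖ < 1 := by simpa [unitBall] using hy.1
    refine hMin.norm_bounds hC₀ hα₀ h0 hx0 hx hy1 ?_
    exact div_le_div_of_nonneg_left (by norm_num) hs0 hy.2.le
  have hmult : ∀ v, (({y ∈ S | f y = v}).encard : ℝ≥0∞) ≤ ENNReal.ofReal (C₁ / s ^ a) := by
    intro v
    have h1 := hM x (by simpa [unitBall] using hx) (1 - s) (by linarith) (by linarith) v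
    rw [sub_sub_cancel] at h1
    refine le_trans (ENat.toENNReal_le.2 ?_) h1
    refine Set.encard_le_encard_of_injOn (f := mobiusT n x) ?_ ?_
    · rintro y ⟨⟨hyB, hys⟩, hyv⟩
      have hy1 : ‖y‖ < 1 := by simpa [unitBall] using hyB
      refine ⟨?_, ?_⟩
      · rw [mem_ball_zero_iff]; linarith
      · rw [mobiusT_neg_mobiusT hx0 hx hy1, hyv]
    · rintro y ⟨⟨hyB, _⟩, _⟩ z ⟨⟨hzB, _⟩, _⟩ hyz
      have hy1 : ‖y‖ < 1 := by simpa [unitBall] using hyB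
      have hz1 : ‖z‖ < 1 := by simpa [unitBall] using hzB
      rw [← mobiusT_neg_mobiusT hx0 hx hy1, hyz, mobiusT_neg_mobiusT hx0 hx hz1]
  calc ∫⁻ y in S, ENNReal.ofReal ((‖fderiv ℝ f y‖ / ‖f y‖) ^ n)
      ≤ ∫⁻ y in S, ENNReal.ofReal K *
          (ENNReal.ofReal |(fderiv ℝ f y).det| * ENNReal.ofReal ((‖f y‖ ^ n)⁻¹)) := by
        refine lintegral_mono_ae ?_
        filter_upwards [ae_restrict_of_ae_restrict_of_subset hSB hQR.2.2] with y hy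
        rw [← ENNReal.ofReal_mul (abs_nonneg _), ← ENNReal.ofReal_mul (by linarith)]
        refine ENNReal.ofReal_le_ofReal ?_
        rw [div_pow, div_eq_mul_inv, ← mul_assoc]
        refine mul_le_mul_of_nonneg_right ?_ (by positivity)
        exact hy.trans (mul_le_mul_of_nonneg_left (le_abs_self _) (by linarith))
    _ = ENNReal.ofReal K * ∫⁻ y in S,
          ENNReal.ofReal |(fderiv ℝ f y).det| * ENNReal.ofReal ((‖f y‖ ^ n)⁻¹) :=
        lintegral_const_mul' _ _ ENNReal.ofReal_ne_top
    _ ≤ ENNReal.ofReal K * (ENNReal.ofReal (C₁ / s ^ a) *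
          (ENNReal.ofReal V * ENNReal.ofReal (Real.log (‖f x‖ * R / (‖f x‖ / R))))) := by
        gcongr
        refine (lintegral_abs_det_fderiv_mul_le volume hSm
          (fun y hy => hQR.2.1 y (hSB hy)) hmult hh).trans ?_
        gcongr
        rw [← hVc]
        refine (lintegral_mono_set hann).trans (lintegral_annulus_le hn1 (by positivity) ?_)
        rw [div_le_iff₀ (by positivity), mul_assoc]
        exact le_mul_of_one_le_right hfx.le (by nlinarith)
    _ ≤ _ := by
        rw [← ENNReal.ofReal_mul hV0, ← ENNReal.ofReal_mul (by positivity),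
          ← ENNReal.ofReal_mul (by linarith)]
        refine ENNReal.ofReal_le_ofReal ?_
        have hlog : Real.log (‖f x‖ * R / (‖f x‖ / R)) = 2 * Real.log R := by
          have : ‖f x‖ * R / (‖f x‖ / R) = R ^ 2 := by field_simp
          rw [this, Real.log_pow]; norm_num
        have hlog2 : Real.log R ≤ C₀ ^ ε * 2 ^ (a' - a) / ε * s ^ (a - a') := by
          refine (Real.log_le_rpow_div (by linarith) hε0).trans (le_of_eq ?_)
          rw [hR, Real.mul_rpow (by linarith) (by positivity), ← Real.rpow_mul (by linarith)]
          have : α₀ * ε = a' - a := by rw [hε]; field_simp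
          rw [this, hu, Real.div_rpow (by norm_num) hs0.le, ← neg_sub a' a, Real.rpow_neg hs0.le]
          ring
        have hs' : s ^ (-a') = s ^ (a - a') / s ^ a := by
          rw [← Real.rpow_sub hs0]; congr 1; ring
        rw [hlog, hs']
        have hsa : 0 < s ^ a := by positivity
        calc K * (C₁ / s ^ a * (V * (2 * Real.log R)))
            ≤ K * (C₁ / s ^ a * (V * (2 * (C₀ ^ ε * 2 ^ (a' - a) / ε * s ^ (a - a'))))) := by
              gcongr
          _ = K * C₁ * V * (2 * (C₀ ^ ε * 2 ^ (a' - a) / ε)) * (s ^ (a - a') / s ^ a) := by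
              ring
          _ ≤ _ := by
              gcongr
              linarith

theorem aemeasurable_energy {n : ℕ} {K : ℝ} {f : Vec n → Vec n} (hQR : IsQR n K f) :
    AEMeasurable (fun y => ENNReal.ofReal ((‖fderiv ℝ f y‖ / ‖f y‖) ^ n))
      (volume.restrict (unitBall n)) := by
  have h1 : AEMeasurable f (volume.restrict (unitBall n)) := hQR.1.aemeasurable measurableSet_ball
  have h2 : AEMeasurable (fderiv ℝ f) (volume.restrict (unitBall n)) :=
    (measurable_fderiv ℝ f).aemeasurable
  exact ((h2.norm.div h1.norm).pow_const n).ennreal_ofReal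

/-- Weighted conformally invariant energy bound. -/
theorem exists_lintegral_weighted_energy_le {n : ℕ} (hn : 2 ≤ n) {K C₀ α₀ a b C₁ : ℝ} (hK : 1 ≤ K)
    (hC₀ : 1 ≤ C₀) (hα₀ : 0 < α₀) (ha0 : 0 ≤ a) (hab : a < b) (hC₁ : 0 < C₁) :
    ∃ D : ℝ, 0 < D ∧ ∀ f : Vec n → Vec n, IsQR n K f → (∀ x ∈ unitBall n, f x ≠ 0) →
      InMiniowitz n C₀ α₀ f → MultCond n a C₁ f → ∀ x : Vec n, x ≠ 0 → ‖x‖ < 1 →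
      ∫⁻ y in unitBall n, ENNReal.ofReal ((‖fderiv ℝ f y‖ / ‖f y‖) ^ n) *
        ENNReal.ofReal ((1 - ‖mobiusT n x y‖) ^ b) ≤ ENNReal.ofReal D := by
  obtain ⟨D, hD, h⟩ := exists_lintegral_energy_le hn hK hC₀ hα₀ ha0
    (show a < (a + b) / 2 by linarith) hC₁
  obtain ⟨D', hD', h'⟩ := exists_lintegral_rpow_le hD (show (a + b) / 2 < b by linarith)
  refine ⟨D', hD', fun f hQR h0 hMin hM x hx0 hx => ?_⟩
  have hρ : Measurable fun y => 1 - ‖mobiusT n x y‖ :=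
    measurable_const.sub (measurable_mobiusT n x).norm
  have hae := aemeasurable_energy hQR
  set m := (volume.restrict (unitBall n)).withDensity
    (fun y => ENNReal.ofReal ((‖fderiv ℝ f y‖ / ‖f y‖) ^ n)) with hm
  have hkey := h' m (fun y => 1 - ‖mobiusT n x y‖) hρ ?_ ?_ (by linarith)
  · rw [hm, lintegral_withDensity_eq_lintegral_mul₀ hae (hρ.pow_const b).ennreal_ofReal.aemeasurable] at hkey
    exact hkey
  · have hac : m ≪ volume.restrict (unitBall n) := withDensity_absolutelyContinuous _ _
    refine hac.ae_le ?_
    filter_upwards [ae_restrict_mem measurableSet_ball] with y hy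
    have hy1 : ‖y‖ < 1 := by simpa [unitBall] using hy
    exact ⟨by linarith [norm_mobiusT_lt_one hx0 hx hy1], by linarith [norm_nonneg (mobiusT n x y)]⟩
  · intro s hs0 hs1
    have hms : MeasurableSet {y | s < 1 - ‖mobiusT n x y‖} := measurableSet_lt measurable_const hρ
    rw [hm, withDensity_apply _ hms, Measure.restrict_restrict hms]
    refine le_trans (le_of_eq ?_) (h f hQR h0 hMin hM x hx0 hx s hs0 hs1)
    congr 2
    ext y
    simp [and_comm]

theorem norm_le_exp_mul_norm_of_lintegral_le {n : ℕ} (hn : 2 ≤ n) {f : Vec n → Vec n}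
    (hd : ∀ x ∈ unitBall n, DifferentiableAt ℝ f x) (h0 : ∀ x ∈ unitBall n, f x ≠ 0)
    {ω : Vec n} (hω : ‖ω‖ = 1) {δ : ℝ} (hδ : 0 < δ) (hδ' : δ ≤ 1 / 2) {β Λ : ℝ}
    (hβ1 : β < 1) (hΛ : 0 ≤ Λ)
    (hint : ∫⁻ t in Ioo (1 - δ) 1, ENNReal.ofReal ((‖fderiv ℝ f (t • ω)‖ / ‖f (t • ω)‖) ^ n *
      (((1 - t) / δ) ^ (β * ((n : ℝ) - 1)) * δ ^ (n - 1))) ≤ ENNReal.ofReal Λ)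
    {s : ℝ} (hs : 1 - δ ≤ s) (hs1 : s < 1) :
    ‖f ((1 - δ) • ω)‖ ≤ Real.exp (1 / (1 - β) + Λ) * ‖f (s • ω)‖ := by
  have hmem : ∀ t ∈ Icc (1 - δ) s, t • ω ∈ unitBall n := by
    intro t ht
    have : 0 ≤ t := by linarith [ht.1]
    simp only [unitBall, mem_ball_zero_iff, norm_smul, hω, mul_one, Real.norm_of_nonneg this]
    linarith [ht.2]
  set φ : ℝ → ℝ := fun t => (‖fderiv ℝ f (t • ω)‖ / ‖f (t • ω)‖) ^ n *
      (((1 - t) / δ) ^ (β * ((n : ℝ) - 1)) * δ ^ (n - 1)) with hφ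
  set ψ : ℝ → ℝ := fun t => -(1 / 2 * Real.log (‖f (t • ω)‖ ^ 2)) +
    ((1 - t) / δ) ^ (1 - β) / (1 - β) with hψ
  set ψ' : ℝ → ℝ := fun t => -(1 / 2 * ((2 * inner ℝ (f (t • ω)) (fderiv ℝ f (t • ω) ω)) /
    ‖f (t • ω)‖ ^ 2)) + ((-1 / δ) * (1 - β) * ((1 - t) / δ) ^ (1 - β - 1)) / (1 - β) with hψ'
  have hderiv : ∀ t ∈ Icc (1 - δ) s, HasDerivAt ψ (ψ' t) t := by
    intro t ht
    have hft : ‖f (t • ω)‖ ^ 2 ≠ 0 := by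
      have := norm_pos_iff.2 (h0 _ (hmem t ht))
      positivity
    have h1 : HasDerivAt (fun t : ℝ => f (t • ω)) (fderiv ℝ f (t • ω) ω) t := by
      have h2 : HasDerivAt (fun t : ℝ => t • ω) ω t := by
        simpa using (hasDerivAt_id t).smul_const ω
      exact (hd _ (hmem t ht)).hasFDerivAt.comp_hasDerivAt t h2
    have h3 : HasDerivAt (fun t : ℝ => (1 - t) / δ) (-1 / δ) t :=
      ((hasDerivAt_id t).const_sub 1).div_const δ
    have hw : (1 - t) / δ ≠ 0 := (div_pos (by linarith [ht.2]) hδ).ne'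
    exact (((h1.norm_sq.log hft).const_mul (1 / 2)).neg).add
      ((h3.rpow_const (Or.inl hw)).div_const (1 - β))
  have hle : ∀ t ∈ Icc (1 - δ) s, ψ' t ≤ φ t := by
    intro t ht
    have hft := norm_pos_iff.2 (h0 _ (hmem t ht))
    have hw : 0 < (1 - t) / δ := div_pos (by linarith [ht.2]) hδ
    set G := ‖fderiv ℝ f (t • ω)‖ / ‖f (t • ω)‖ with hG
    have hG0 : 0 ≤ G := by positivity
    set X := ((1 - t) / δ) ^ (-β) / δ with hX
    have hX0 : 0 < X := by positivity
    set Y := ((1 - t) / δ) ^ (β * ((n : ℝ) - 1)) * δ ^ (n - 1) with hY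
    have hY0 : 0 < Y := by positivity
    have hXY : Y * X ^ (n - 1) = 1 := by
      have : (((1 - t) / δ) ^ (-β)) ^ (n - 1) = (((1 - t) / δ) ^ (β * ((n : ℝ) - 1)))⁻¹ := by
        rw [← Real.rpow_natCast, ← Real.rpow_mul hw.le, ← Real.rpow_neg hw.le]
        congr 1
        rw [Nat.cast_sub (by omega)]
        push_cast
        ring
      rw [hY, hX, div_pow, this]
      have := Real.rpow_pos_of_pos hw (β * ((n : ℝ) - 1))
      field_simp
    have h1 : -(1 / 2 * ((2 * inner ℝ (f (t • ω)) (fderiv ℝ f (t • ω) ω)) /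
        ‖f (t • ω)‖ ^ 2)) ≤ G := by
      have h2 := abs_le.1 (abs_real_inner_le_norm (f (t • ω)) (fderiv ℝ f (t • ω) ω))
      have h3 := (fderiv ℝ f (t • ω)).le_opNorm ω
      rw [hω, mul_one] at h3
      have h4 : ‖f (t • ω)‖ * ‖fderiv ℝ f (t • ω) ω‖ ≤
        ‖f (t • ω)‖ * ‖fderiv ℝ f (t • ω)‖ := by gcongr
      have : -(1 / 2 * ((2 * inner ℝ (f (t • ω)) (fderiv ℝ f (t • ω) ω)) /
        ‖f (t • ω)‖ ^ 2)) = (-inner ℝ (f (t • ω)) (fderiv ℝ f (t • ω) ω)) / ‖f (t • ω)‖ ^ 2 := by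
        ring
      rw [this, hG, div_le_div_iff₀ (by positivity) hft, pow_two, ← mul_assoc]
      exact mul_le_mul_of_nonneg_right (by linarith [h2.1]) hft.le
    have h2 : ((-1 / δ) * (1 - β) * ((1 - t) / δ) ^ (1 - β - 1)) / (1 - β) = -X := by
      have h3 : 1 - β ≠ 0 := by linarith
      rw [hX, show 1 - β - 1 = -β by ring]
      field_simp
    have h3 : G ≤ X + G ^ n * Y := by
      rcases le_total G X with h | h
      · have : 0 ≤ G ^ n * Y := by positivity
        linarith
      · have h4 : Y * X ^ (n - 1) ≤ Y * G ^ (n - 1) := by gcongr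
        have h5 : G ^ n = G * G ^ (n - 1) := by rw [← pow_succ']; congr 1; omega
        rw [hXY] at h4
        rw [h5]
        nlinarith
    simp only [hψ', hφ]
    rw [h2]
    linarith
  have hsub : Ioc (1 - δ) s ⊆ Ioo (1 - δ) 1 := fun t ht => ⟨ht.1, ht.2.trans_lt hs1⟩
  have hφ0 : ∀ t ∈ Ioc (1 - δ) s, 0 ≤ φ t := by
    intro t ht
    have : 0 ≤ (1 - t) / δ := div_nonneg (by linarith [ht.2]) hδ.le
    simp only [hφ]
    positivity
  have hφ0' : 0 ≤ᵐ[volume.restrict (Ioc (1 - δ) s)] φ := by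
    filter_upwards [ae_restrict_mem measurableSet_Ioc] with t ht using hφ0 t ht
  have hφm : AEStronglyMeasurable φ (volume.restrict (Ioc (1 - δ) s)) := by
    have h1 : Measurable fun t : ℝ => fderiv ℝ f (t • ω) :=
      (measurable_fderiv ℝ f).comp (by fun_prop)
    have h2 : ContinuousOn (fun t : ℝ => f (t • ω)) (Ioc (1 - δ) s) := fun t ht =>
      ((hd _ (hmem t (Ioc_subset_Icc_self ht))).continuousAt.comp
        (f := fun t : ℝ => t • ω) (by fun_prop)).continuousWithinAt
    have h3 := h2.aemeasurable (μ := volume) measurableSet_Ioc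
    have h4 : Measurable fun t : ℝ => ((1 - t) / δ) ^ (β * ((n : ℝ) - 1)) * δ ^ (n - 1) :=
      (Measurable.pow_const (by fun_prop) _).mul_const _
    exact (((h1.norm.aemeasurable.div h3.norm).pow_const n).mul
      h4.aemeasurable).aestronglyMeasurable
  have hlin : ∫⁻ t in Ioc (1 - δ) s, ENNReal.ofReal (φ t) ≤ ENNReal.ofReal Λ :=
    (lintegral_mono_set hsub).trans hint
  have hφi : IntegrableOn φ (Ioc (1 - δ) s) := by
    refine ⟨hφm, ?_⟩
    rw [hasFiniteIntegral_iff_ofReal hφ0']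
    exact hlin.trans_lt ENNReal.ofReal_lt_top
  have hFTC := intervalIntegral.sub_le_integral_of_hasDeriv_right_of_le hs
    (fun t ht => (hderiv t ht).continuousAt.continuousWithinAt)
    (fun t ht => (hderiv t (Ioo_subset_Icc_self ht)).hasDerivWithinAt)
    (by rwa [integrableOn_Icc_iff_integrableOn_Ioc])
    (fun t ht => hle t (Ioo_subset_Icc_self ht))
  rw [intervalIntegral.integral_of_le hs, integral_eq_lintegral_of_nonneg_ae hφ0' hφm] at hFTC
  have hI := ENNReal.toReal_mono ENNReal.ofReal_ne_top hlin
  rw [ENNReal.toReal_ofReal hΛ] at hI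
  have hA := norm_pos_iff.2 (h0 _ (hmem _ ⟨le_rfl, hs⟩))
  have hB := norm_pos_iff.2 (h0 _ (hmem s ⟨hs, le_rfl⟩))
  have hX : 0 ≤ ((1 - s) / δ) ^ (1 - β) / (1 - β) := by
    have : 0 < (1 - s) / δ := div_pos (by linarith) hδ
    have : 0 < 1 - β := by linarith
    positivity
  simp only [hψ, Real.log_pow, sub_sub_cancel, div_self hδ.ne', Real.one_rpow] at hFTC
  push_cast at hFTC
  rw [← Real.log_le_log_iff hA (by positivity), Real.log_mul (by positivity) hB.ne', Real.log_exp]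
  linarith

theorem measurable_weighted_energy {n : ℕ} {K : ℝ} {f : Vec n → Vec n} (hQR : IsQR n K f)
    (x : Vec n) (b : ℝ) : Measurable ((unitBall n).indicator fun y =>
      ENNReal.ofReal ((‖fderiv ℝ f y‖ / ‖f y‖) ^ n) *
        ENNReal.ofReal ((1 - ‖mobiusT n x y‖) ^ b)) := by
  have hB : MeasurableSet (unitBall n) := measurableSet_ball
  have h1 : Measurable ((unitBall n).indicator f) := by
    rw [← Set.piecewise_eq_indicator]
    exact hQR.1.measurable_piecewise continuousOn_const hB
  have h2 : Measurable fun y => 1 - ‖mobiusT n x y‖ :=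
    measurable_const.sub (measurable_mobiusT n x).norm
  have h3 := (((((measurable_fderiv ℝ f).norm.div h1.norm).pow_const n).ennreal_ofReal).mul
    (h2.pow_const b).ennreal_ofReal).indicator hB
  convert h3 using 1
  ext y
  by_cases hy : y ∈ unitBall n <;> simp [hy]

theorem HasNTLimit.tendsto_radial {n : ℕ} {κ : ℝ} (hκ : 0 < κ) {f : Vec n → Vec n} {ω L : Vec n}
    (hω : ‖ω‖ = 1) (h : HasNTLimit n κ f ω L) :
    Tendsto (fun s : ℝ => f (s • ω)) (𝓝[<] 1) (𝓝 L) := by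
  refine Tendsto.comp h (tendsto_nhdsWithin_iff.2 ⟨?_, ?_⟩)
  · have : Continuous fun s : ℝ => s • ω := by fun_prop
    simpa using (this.tendsto 1).mono_left nhdsWithin_le_nhds
  · filter_upwards [Ioo_mem_nhdsLT (show (0 : ℝ) < 1 by norm_num)] with s hs
    have hn : ‖s • ω‖ = s := by rw [norm_smul, hω, mul_one, Real.norm_of_nonneg hs.1.le]
    refine ⟨by simpa [unitBall, hn] using hs.2, ?_⟩
    have h1 : s • ω - ω = (s - 1) • ω := by rw [sub_smul, one_smul]
    rw [hn, h1, norm_smul, hω, mul_one, Real.norm_eq_abs, abs_sub_comm,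
      abs_of_pos (by linarith [hs.2])]
    nlinarith [hs.2]

theorem ae_coneMeasure_of_ae_sphMeasure {n : ℕ} (hn : 2 ≤ n) {P : Vec n → Prop}
    (h : ∀ᵐ ω ∂(sphMeasure n), P ω) : ∀ᵐ ω : sphere (0 : Vec n) 1 ∂(coneMeasure n), P ω := by
  obtain ⟨C, hC⟩ := exists_map_coneMeasure_le hn
  have hac : (coneMeasure n).map (Subtype.val) ≪ sphMeasure n :=
    Measure.absolutelyContinuous_of_le_smul hC
  exact ae_of_ae_map measurable_subtype_coe.aemeasurable (hac.ae_le h)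

/-- On a fixed proportion of a spherical cap the boundary values of `f` are not much smaller than
the value of `f` at the point above the centre of the cap. -/
theorem exists_le_coneMeasure_cap {n : ℕ} (hn : 2 ≤ n) {K C₀ α₀ a C₁ κ : ℝ} (hK : 1 ≤ K)
    (hC₀ : 1 ≤ C₀) (hα₀ : 0 < α₀) (ha0 : 0 ≤ a) (ha : a < (n : ℝ) - 1) (hC₁ : 0 < C₁)
    (hκ : 0 < κ) :
    ∃ c : ℝ, 0 < c ∧ ∃ c' : ℝ, 0 < c' ∧ ∀ f : Vec n → Vec n, IsQR n K f →
      (∀ x ∈ unitBall n, f x ≠ 0) → InMiniowitz n C₀ α₀ f → MultCond n a C₁ f →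
      ∀ g : Vec n → Vec n, (∀ᵐ ω ∂(sphMeasure n), HasNTLimit n κ f ω (g ω)) →
      ∀ ω₀ : sphere (0 : Vec n) 1, ∀ δ : ℝ, 0 < δ → δ ≤ 1 / 2 →
        ENNReal.ofReal (c' * δ ^ (n - 1)) ≤ coneMeasure n
          (ball ω₀ δ ∩ {ω | c * ‖f ((1 - δ) • (ω₀ : Vec n))‖ ≤ ‖g ω‖}) := by
  have hn1 : 1 ≤ n := by omega
  have hnr : (0 : ℝ) < (n : ℝ) - 1 := lt_of_le_of_lt ha0 ha
  have : Nonempty (Fin n) := ⟨⟨0, hn1⟩⟩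
  set b := (a + ((n : ℝ) - 1)) / 2 with hb
  have hb0 : 0 < b := by linarith
  set β := b / ((n : ℝ) - 1) with hβ
  have hβb : β * ((n : ℝ) - 1) = b := by rw [hβ]; field_simp
  have hβ1 : β < 1 := by rw [hβ, div_lt_one hnr]; linarith
  obtain ⟨D, hD, hen⟩ := exists_lintegral_weighted_energy_le hn hK hC₀ hα₀ ha0
    (show a < b by linarith) hC₁
  set V := (volume (ball (0 : Vec n) 1)).toReal with hV
  have hV0 : 0 < V := ENNReal.toReal_pos (measure_ball_pos _ _ one_pos).ne' measure_ball_lt_top.ne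
  set c₁ := V / 16 ^ n with hc₁
  have hc₁0 : 0 < c₁ := by positivity
  set L := 2 * (2 ^ (n - 1) * D) / c₁ with hL
  have hL0 : 0 < L := by positivity
  set Λ := 32 ^ b * L with hΛ
  have hΛ0 : 0 < Λ := by positivity
  set A := Real.exp (1 / (1 - β) + Λ) * (C₀ * 64 ^ α₀) with hA
  have hA0 : 0 < A := by positivity
  refine ⟨A⁻¹, by positivity, c₁ / 2, by positivity, ?_⟩
  intro f hQR h0 hMin hM g hg ω₀ δ hδ hδ'
  have hω₀ : ‖(ω₀ : Vec n)‖ = 1 := by simp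
  set x := (1 - δ) • (ω₀ : Vec n) with hx
  have hxn : ‖x‖ = 1 - δ := by
    rw [hx, norm_smul, hω₀, mul_one, Real.norm_of_nonneg (by linarith)]
  have hx0 : x ≠ 0 := by rw [← norm_pos_iff, hxn]; linarith
  have hx1 : ‖x‖ < 1 := by rw [hxn]; linarith
  set F : Vec n → ℝ≥0∞ := (unitBall n).indicator fun y =>
      ENNReal.ofReal ((‖fderiv ℝ f y‖ / ‖f y‖) ^ n) *
        ENNReal.ofReal ((1 - ‖mobiusT n x y‖) ^ b) with hF
  have hFm : Measurable F := measurable_weighted_energy hQR x b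
  set J : sphere (0 : Vec n) 1 → ℝ≥0∞ := fun ω => ∫⁻ t in Ioo (1 - δ) 1, F (t • (ω : Vec n))
    with hJ
  have hJm : Measurable J := by
    have h1 : Measurable fun q : sphere (0 : Vec n) 1 × ℝ => F (q.2 • (q.1 : Vec n)) :=
      hFm.comp (by fun_prop)
    exact h1.lintegral_prod_right'
  have hJle : ∫⁻ ω, J ω ∂(coneMeasure n) ≤ ENNReal.ofReal (2 ^ (n - 1) * D) := by
    refine (lintegral_sphere_Ioo_le hn1 hFm hδ').trans ?_
    rw [ENNReal.ofReal_mul (by positivity)]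
    gcongr
    rw [hF, lintegral_indicator (show MeasurableSet (unitBall n) from measurableSet_ball)]
    exact hen f hQR h0 hMin hM x hx0 hx1
  have hcheb : coneMeasure n {ω | ENNReal.ofReal (L / δ ^ (n - 1)) ≤ J ω} ≤
      ENNReal.ofReal (c₁ / 2 * δ ^ (n - 1)) := by
    have h1 := (mul_meas_ge_le_lintegral₀ (μ := coneMeasure n) hJm.aemeasurable
      (ENNReal.ofReal (L / δ ^ (n - 1)))).trans hJle
    have h2 : ENNReal.ofReal (2 ^ (n - 1) * D) =
        ENNReal.ofReal (L / δ ^ (n - 1)) * ENNReal.ofReal (c₁ / 2 * δ ^ (n - 1)) := by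
      rw [← ENNReal.ofReal_mul (by positivity)]
      congr 1
      rw [hL]
      field_simp
    rw [h2] at h1
    exact (ENNReal.mul_le_mul_iff_right (by simp; positivity) ENNReal.ofReal_ne_top).1 h1
  have hcap : ENNReal.ofReal (c₁ * δ ^ (n - 1)) ≤ coneMeasure n (ball ω₀ δ) := by
    have h1 := le_coneMeasure_ball hn1 ω₀ hδ hδ'
    have h2 : ENNReal.ofReal ((δ / 16) ^ n) * volume (ball (0 : Vec n) 1) =
        ENNReal.ofReal δ * ENNReal.ofReal (c₁ * δ ^ (n - 1)) := by
      rw [← ENNReal.ofReal_toReal (measure_ball_lt_top (μ := volume) (x := (0 : Vec n))).ne, ← hV,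
        ← ENNReal.ofReal_mul (by positivity), ← ENNReal.ofReal_mul hδ.le]
      congr 1
      have h3 : δ ^ n = δ * δ ^ (n - 1) := by rw [← pow_succ']; congr 1; omega
      rw [hc₁, div_pow, h3]
      ring
    rw [h2] at h1
    exact (ENNReal.mul_le_mul_iff_right (by simpa using hδ) ENNReal.ofReal_ne_top).1 h1
  have hdiff : ENNReal.ofReal (c₁ / 2 * δ ^ (n - 1)) ≤
      coneMeasure n (ball ω₀ δ \ {ω | ENNReal.ofReal (L / δ ^ (n - 1)) ≤ J ω}) := by
    have h1 : ENNReal.ofReal (c₁ * δ ^ (n - 1)) = ENNReal.ofReal (c₁ / 2 * δ ^ (n - 1)) +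
        ENNReal.ofReal (c₁ / 2 * δ ^ (n - 1)) := by
      rw [← ENNReal.ofReal_add (by positivity) (by positivity)]
      congr 1; ring
    refine le_trans ?_ le_measure_sdiff
    refine ENNReal.le_sub_of_add_le_right (measure_ne_top _ _) ?_
    exact (add_le_add le_rfl hcheb).trans (h1 ▸ hcap)
  refine hdiff.trans (measure_mono_ae ?_)
  filter_upwards [ae_coneMeasure_of_ae_sphMeasure hn hg] with ω hNT hωm
  have hωm' : ω ∈ ball ω₀ δ ∧ J ω < ENNReal.ofReal (L / δ ^ (n - 1)) := ⟨hωm.1, not_le.1 hωm.2⟩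
  refine ⟨hωm'.1, ?_⟩
  have hω : ‖(ω : Vec n)‖ = 1 := by simp
  have hωω₀ : ‖(ω : Vec n) - ω₀‖ < δ := by
    have := hωm'.1
    rwa [mem_ball, Subtype.dist_eq, dist_eq_norm] at this
  have hgeom : ∀ t : ℝ, 1 - δ ≤ t → t < 1 → ‖t • (ω : Vec n)‖ = t ∧
      (1 - t) / (32 * δ) ≤ 1 - ‖mobiusT n x (t • (ω : Vec n))‖ := by
    intro t ht ht1
    have hnt : ‖t • (ω : Vec n)‖ = t := by
      rw [norm_smul, hω, mul_one, Real.norm_of_nonneg (by linarith)]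
    refine ⟨hnt, ?_⟩
    have h1 := le_one_sub_norm_mobiusT (y := t • (ω : Vec n)) hω₀ hδ hδ' (by linarith) ?_
    · rwa [hnt] at h1
    · have h2 : t • (ω : Vec n) - ω₀ = (t - 1) • (ω : Vec n) + (ω - ω₀) := by
        rw [sub_smul, one_smul]; abel
      rw [h2]
      refine (norm_add_le _ _).trans ?_
      rw [norm_smul, hω, mul_one, Real.norm_eq_abs, abs_sub_comm, abs_of_pos (by linarith)]
      linarith
  have hint : ∫⁻ t in Ioo (1 - δ) 1, ENNReal.ofReal
      ((‖fderiv ℝ f (t • (ω : Vec n))‖ / ‖f (t • (ω : Vec n))‖) ^ n *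
      (((1 - t) / δ) ^ (β * ((n : ℝ) - 1)) * δ ^ (n - 1))) ≤ ENNReal.ofReal Λ := by
    calc _ ≤ ∫⁻ t in Ioo (1 - δ) 1, ENNReal.ofReal (32 ^ b * δ ^ (n - 1)) *
          F (t • (ω : Vec n)) := by
          refine setLIntegral_mono' measurableSet_Ioo fun t ht => ?_
          obtain ⟨hnt, hT⟩ := hgeom t ht.1.le ht.2
          have htB : t • (ω : Vec n) ∈ unitBall n := by simpa [unitBall, hnt] using ht.2
          have hw : 0 ≤ (1 - t) / δ := div_nonneg (by linarith [ht.2]) hδ.le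
          rw [hF, indicator_of_mem htB, ← ENNReal.ofReal_mul (by positivity),
            ← ENNReal.ofReal_mul (by positivity), hβb]
          refine ENNReal.ofReal_le_ofReal ?_
          have h1 : ((1 - t) / δ) ^ b ≤ 32 ^ b * (1 - ‖mobiusT n x (t • (ω : Vec n))‖) ^ b := by
            have h2 : (1 - t) / δ = 32 * ((1 - t) / (32 * δ)) := by field_simp
            have h3 : 0 ≤ (1 - t) / (32 * δ) := div_nonneg (by linarith [ht.2]) (by positivity)
            rw [h2, Real.mul_rpow (by norm_num) h3]
            gcongr
          calc _ ≤ (‖fderiv ℝ f (t • (ω : Vec n))‖ / ‖f (t • (ω : Vec n))‖) ^ n *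
              ((32 ^ b * (1 - ‖mobiusT n x (t • (ω : Vec n))‖) ^ b) * δ ^ (n - 1)) := by gcongr
            _ = _ := by ring
      _ = ENNReal.ofReal (32 ^ b * δ ^ (n - 1)) * J ω :=
          lintegral_const_mul' _ _ ENNReal.ofReal_ne_top
      _ ≤ ENNReal.ofReal (32 ^ b * δ ^ (n - 1)) * ENNReal.ofReal (L / δ ^ (n - 1)) := by
          gcongr
          exact hωm'.2.le
      _ = ENNReal.ofReal Λ := by
          rw [← ENNReal.ofReal_mul (by positivity)]
          congr 1
          rw [hΛ]
          field_simp
  have hlim : ‖f ((1 - δ) • (ω : Vec n))‖ ≤ Real.exp (1 / (1 - β) + Λ) * ‖g ω‖ := by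
    refine ge_of_tendsto ((hNT.tendsto_radial hκ hω).norm.const_mul _) ?_
    filter_upwards [Ioo_mem_nhdsLT (show 1 - δ < 1 by linarith)] with s hs
    exact norm_le_exp_mul_norm_of_lintegral_le hn hQR.2.1 h0 hω hδ hδ' hβ1 hΛ0.le hint hs.1.le hs.2
  obtain ⟨hnt, hT⟩ := hgeom (1 - δ) le_rfl (by linarith)
  have hT' : (1 : ℝ) / 32 ≤ 1 - ‖mobiusT n x ((1 - δ) • (ω : Vec n))‖ := by
    refine le_trans (le_of_eq ?_) hT
    field_simp
    ring
  have hmin := (hMin.norm_bounds hC₀ hα₀ h0 hx0 hx1 (y := (1 - δ) • (ω : Vec n)) (u := 64)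
    (by rw [hnt]; linarith) (by rw [div_le_iff₀ (by linarith)]; linarith)).1
  have h64 : 0 < C₀ * 64 ^ α₀ := by positivity
  rw [div_le_iff₀ h64] at hmin
  change A⁻¹ * ‖f x‖ ≤ ‖g ω‖
  rw [inv_mul_le_iff₀ hA0]
  calc ‖f x‖ ≤ _ := hmin
    _ ≤ (Real.exp (1 / (1 - β) + Λ) * ‖g ω‖) * (C₀ * 64 ^ α₀) := by gcongr
    _ = A * ‖g ω‖ := by rw [hA]; ring

theorem ENNReal.tsum_rpow_le_rpow_tsum {ι : Type*} (m : ι → ℝ≥0∞) {α : ℝ} (hα : 1 ≤ α) :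
    ∑' i, m i ^ α ≤ (∑' i, m i) ^ α := by
  have h : ∀ y : ℝ≥0∞, y ^ α = y * y ^ (α - 1) := fun y => by
    conv_rhs => rw [← ENNReal.rpow_one y, ← ENNReal.rpow_mul, one_mul,
      ← ENNReal.rpow_add_of_nonneg _ _ zero_le_one (by linarith)]
    congr 1; ring
  calc ∑' i, m i ^ α = ∑' i, m i * m i ^ (α - 1) := by simp_rw [← h]
    _ ≤ ∑' i, m i * (∑' j, m j) ^ (α - 1) := by
        refine ENNReal.tsum_le_tsum fun i => ?_
        gcongr
        exact ENNReal.le_tsum i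
    _ = (∑' i, m i) ^ α := by rw [ENNReal.tsum_mul_right, h]

/-- Every point of the ball lies above a cap whose central value controls the value of `f`. -/
theorem exists_cap_of_mem_unitBall {n : ℕ} (hn : 1 ≤ n) {C₀ α₀ : ℝ} (hC₀ : 1 ≤ C₀) (hα₀ : 0 < α₀)
    {f : Vec n → Vec n} (h0 : ∀ x ∈ unitBall n, f x ≠ 0) (hMin : InMiniowitz n C₀ α₀ f)
    {x : Vec n} (hx : x ∈ unitBall n) :
    ∃ (ω : sphere (0 : Vec n) 1) (δ : ℝ), 0 < δ ∧ δ ≤ 1 / 2 ∧ ‖x - ω‖ ≤ 3 * δ ∧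
      ‖f x‖ ≤ ‖f ((1 - δ) • (ω : Vec n))‖ * (C₀ * 64 ^ α₀) := by
  have : Nonempty (Fin n) := ⟨⟨0, hn⟩⟩
  have hx1 : ‖x‖ < 1 := by simpa [unitBall] using hx
  suffices h : ∃ (ω : sphere (0 : Vec n) 1) (δ : ℝ), 0 < δ ∧ δ ≤ 1 / 2 ∧ ‖x - ω‖ ≤ 3 * δ ∧
      δ ≤ 1 - ‖x‖ by
    obtain ⟨ω, δ, hδ, hδ', hxω, hδx⟩ := h
    have hω : ‖(ω : Vec n)‖ = 1 := by simp
    have hxn : ‖(1 - δ) • (ω : Vec n)‖ = 1 - δ := by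
      rw [norm_smul, hω, mul_one, Real.norm_of_nonneg (by linarith)]
    refine ⟨ω, δ, hδ, hδ', hxω, ?_⟩
    refine (hMin.norm_bounds hC₀ hα₀ h0 ?_ ?_ hx1 (u := 64) ?_).2
    · rw [← norm_pos_iff, hxn]; linarith
    · rw [hxn]; linarith
    · have h1 := le_one_sub_norm_mobiusT hω hδ hδ' hx1 hxω
      have h2 : (1 : ℝ) / 32 ≤ (1 - ‖x‖) / (32 * δ) := by
        rw [div_le_div_iff₀ (by norm_num) (by positivity)]; linarith
      rw [div_le_iff₀ (by linarith)]
      linarith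
  rcases le_or_gt (1 / 2) ‖x‖ with h | h
  · have hx0 : 0 < ‖x‖ := by linarith
    refine ⟨⟨‖x‖⁻¹ • x, by simp [norm_smul, hx0.ne']⟩, 1 - ‖x‖, by linarith, by linarith, ?_, le_rfl⟩
    have h1 : x - ‖x‖⁻¹ • x = (1 - ‖x‖⁻¹) • x := by rw [sub_smul, one_smul]
    have h2 : 1 ≤ ‖x‖⁻¹ := (one_le_inv₀ hx0).2 hx1.le
    simp only [h1, norm_smul, Real.norm_eq_abs]
    rw [abs_sub_comm, abs_of_nonneg (by linarith), sub_mul, inv_mul_cancel₀ hx0.ne']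
    linarith
  · refine ⟨⟨EuclideanSpace.single ⟨0, hn⟩ 1, by simp⟩, 1 / 2, by norm_num, le_rfl, ?_, by linarith⟩
    refine (norm_sub_le _ _).trans ?_
    simp only [PiLp.norm_single, norm_one]
    linarith

/-- Superlevel sets of `f` inside the ball are controlled by superlevel sets of its boundary
values. -/
theorem exists_measure_superlevel_le {n : ℕ} (hn : 2 ≤ n) {K C₀ α₀ a C₁ κ α γ : ℝ} (hK : 1 ≤ K)
    (hC₀ : 1 ≤ C₀) (hα₀ : 0 < α₀) (ha0 : 0 ≤ a) (ha : a < (n : ℝ) - 1) (hC₁ : 0 < C₁)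
    (hκ : 0 < κ) (hα : 1 ≤ α) :
    ∃ c : ℝ, 0 < c ∧ ∃ C : ℝ≥0∞, C ≠ ⊤ ∧ ∀ μ : Measure (Vec n), IsAlphaCarleson n α γ μ →
      ∀ f : Vec n → Vec n, IsQR n K f → (∀ x ∈ unitBall n, f x ≠ 0) →
      InMiniowitz n C₀ α₀ f → MultCond n a C₁ f →
      ∀ g : Vec n → Vec n, (∀ᵐ ω ∂(sphMeasure n), HasNTLimit n κ f ω (g ω)) →
      ∀ t : ℝ, μ {x ∈ unitBall n | t < ‖f x‖} ≤
        C * coneMeasure n {ω : sphere (0 : Vec n) 1 | t < ‖g ω‖ / c} ^ α := by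
  have hn1 : 1 ≤ n := by omega
  have hnr : (0 : ℝ) < (n : ℝ) - 1 := lt_of_le_of_lt ha0 ha
  obtain ⟨c, hc, c', hc', hcap⟩ := exists_le_coneMeasure_cap hn hK hC₀ hα₀ ha0 ha hC₁ hκ
  set A := C₀ * 64 ^ α₀ with hA
  have hA0 : 0 < A := by positivity
  set M := 16 ^ (n - 1) / c' with hM
  have hM0 : 0 < M := by positivity
  refine ⟨c / A, by positivity, ENNReal.ofReal γ * ENNReal.ofReal M ^ α,
    ENNReal.mul_ne_top ENNReal.ofReal_ne_top
      (ENNReal.rpow_ne_top_of_nonneg (by linarith) ENNReal.ofReal_ne_top), ?_⟩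
  intro μ hμ f hQR h0 hMin hMul g hg t
  set E := {x ∈ unitBall n | t < ‖f x‖} with hE
  set W := {ω : sphere (0 : Vec n) 1 | t < ‖g ω‖ / (c / A)} with hW
  have hex : ∀ x : E, ∃ (ω : sphere (0 : Vec n) 1) (δ : ℝ), 0 < δ ∧ δ ≤ 1 / 2 ∧
      ‖(x : Vec n) - ω‖ ≤ 3 * δ ∧ ‖f x‖ ≤ ‖f ((1 - δ) • (ω : Vec n))‖ * A :=
    fun x => exists_cap_of_mem_unitBall hn1 hC₀ hα₀ h0 hMin x.2.1
  choose ω δ hδ hδ' hxω hfx using hex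
  obtain ⟨u, -, hdisj, hcov⟩ := Vitali.exists_disjoint_subfamily_covering_enlargement_closedBall
    (univ : Set E) (fun x => (ω x : Vec n)) (fun x => 3 * δ x) (3 / 2)
    (fun x _ => by linarith [hδ' x]) 5 (by norm_num)
  have hu : u.Countable := by
    refine hdisj.countable_of_nonempty_interior fun i _ => ?_
    refine ⟨ω i, ball_subset_interior_closedBall (mem_ball_self ?_)⟩
    linarith [hδ i]
  have hsub : E ⊆ ⋃ i ∈ u, unitBall n ∩ ball (ω i : Vec n) (16 * δ i) := by
    intro x hx
    obtain ⟨i, hi, hsi⟩ := hcov ⟨x, hx⟩ (mem_univ _)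
    have h1 : x ∈ closedBall (ω ⟨x, hx⟩ : Vec n) (3 * δ ⟨x, hx⟩) := by
      rw [mem_closedBall, dist_eq_norm]
      exact hxω ⟨x, hx⟩
    have h2 := hsi h1
    rw [mem_closedBall] at h2
    refine mem_biUnion hi ⟨hx.1, ?_⟩
    rw [mem_ball]
    linarith [hδ i]
  have hterm : ∀ i : E, μ (unitBall n ∩ ball (ω i : Vec n) (16 * δ i)) ≤
      ENNReal.ofReal γ * ENNReal.ofReal M ^ α * (coneMeasure n (ball (ω i) (δ i) ∩ W)) ^ α := by
    intro i
    have hδi := hδ i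
    refine (hμ (ω i) (ω i).2 (16 * δ i) (by positivity)).trans ?_
    have h1 : ENNReal.ofReal (16 * δ i) ^ (α * ((n : ℝ) - 1)) =
        (ENNReal.ofReal M * ENNReal.ofReal (c' * δ i ^ (n - 1))) ^ α := by
      rw [mul_comm α, ENNReal.rpow_mul]
      congr 1
      have h2 : (n : ℝ) - 1 = ((n - 1 : ℕ) : ℝ) := by rw [Nat.cast_sub hn1]; simp
      rw [h2, ENNReal.rpow_natCast, ← ENNReal.ofReal_pow (by positivity),
        ← ENNReal.ofReal_mul hM0.le]
      congr 1
      rw [hM, mul_pow]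
      field_simp
    rw [h1, ENNReal.mul_rpow_of_nonneg _ _ (by linarith), ← mul_assoc]
    gcongr
    refine (hcap f hQR h0 hMin hMul g hg (ω i) (δ i) hδi (hδ' i)).trans (measure_mono ?_)
    rintro ζ ⟨hζ, hζ'⟩
    refine ⟨hζ, ?_⟩
    have h3 : t < ‖f ((1 - δ i) • (ω i : Vec n))‖ * A := lt_of_lt_of_le i.2.2 (hfx i)
    have h4 : c * ‖f ((1 - δ i) • (ω i : Vec n))‖ ≤ ‖g ζ‖ := hζ'
    change t < ‖g ζ‖ / (c / A)
    rw [div_div_eq_mul_div, lt_div_iff₀ hc]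
    calc t * c < ‖f ((1 - δ i) • (ω i : Vec n))‖ * A * c := by gcongr
      _ = c * ‖f ((1 - δ i) • (ω i : Vec n))‖ * A := by ring
      _ ≤ ‖g ζ‖ * A := by gcongr
  have hsum : ∑' i : u, coneMeasure n (ball (ω i) (δ i) ∩ W) ≤ coneMeasure n W := by
    have h1 := tsum_meas_le_meas_iUnion_of_disjoint ((coneMeasure n).restrict W)
      (As := fun i : u => ball (ω i) (δ i)) (fun i => measurableSet_ball) ?_
    · simp_rw [Measure.restrict_apply measurableSet_ball] at h1
      exact h1.trans ((measure_mono (subset_univ _)).trans (by simp))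
    · intro i j hij
      refine Set.disjoint_left.2 fun ζ hζi hζj => ?_
      have h2 := hdisj i.2 j.2 (fun h => hij (Subtype.ext h))
      rw [mem_ball, Subtype.dist_eq] at hζi hζj
      have h3 : (ζ : Vec n) ∈ closedBall (ω i : Vec n) (3 * δ i) :=
        mem_closedBall.2 (by linarith [hδ i])
      have h4 : (ζ : Vec n) ∈ closedBall (ω j : Vec n) (3 * δ j) :=
        mem_closedBall.2 (by linarith [hδ j])
      exact Set.disjoint_left.1 h2 h3 h4
  calc μ E ≤ ∑' i : u, μ (unitBall n ∩ ball (ω i : Vec n) (16 * δ i)) :=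
        (measure_mono hsub).trans (measure_biUnion_le μ hu _)
    _ ≤ ∑' i : u, ENNReal.ofReal γ * ENNReal.ofReal M ^ α *
          (coneMeasure n (ball (ω i) (δ i) ∩ W)) ^ α :=
        ENNReal.tsum_le_tsum fun i => hterm i
    _ ≤ _ := by
        rw [ENNReal.tsum_mul_left]
        gcongr
        exact (ENNReal.tsum_rpow_le_rpow_tsum _ hα).trans
          (ENNReal.rpow_le_rpow hsum (by linarith))

/-- A power-type comparison of distribution functions gives a comparison of integrals. -/
theorem lintegral_rpow_le_of_measure_lt_le {X Y : Type*} [MeasurableSpace X] [MeasurableSpace Y]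
    {μ : Measure X} {ν : Measure Y} {F : X → ℝ} {h : Y → ℝ} (hF0 : ∀ x, 0 ≤ F x)
    (hh0 : ∀ y, 0 ≤ h y) (hF : AEMeasurable F μ) (hh : AEMeasurable h ν) {p α : ℝ} (hp : 0 < p)
    (hα : 1 ≤ α) {C : ℝ≥0∞} (hC : C ≠ ⊤)
    (H : ∀ t : ℝ, 0 < t → μ {x | t < F x} ≤ C * ν {y | t < h y} ^ α)
    (hJ : ∫⁻ y, ENNReal.ofReal (h y ^ p) ∂ν ≠ ⊤) :
    ∫⁻ x, ENNReal.ofReal (F x ^ (α * p)) ∂μ ≤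
      C * ENNReal.ofReal α * (∫⁻ y, ENNReal.ofReal (h y ^ p) ∂ν) ^ α := by
  set J := ∫⁻ y, ENNReal.ofReal (h y ^ p) ∂ν with hJdef
  have hα0 : 0 < α := by linarith
  have hpow : ∀ y : ℝ≥0∞, y ^ α = y * y ^ (α - 1) := fun y => by
    conv_rhs => rw [← ENNReal.rpow_one y, ← ENNReal.rpow_mul, one_mul,
      ← ENNReal.rpow_add_of_nonneg _ _ zero_le_one (by linarith)]
    congr 1; ring
  have hcheb : ∀ t : ℝ, 0 < t → ν {y | t < h y} * ENNReal.ofReal (t ^ p) ≤ J := by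
    intro t ht
    refine le_trans ?_ (mul_meas_ge_le_lintegral₀ ((hh.pow_const p).ennreal_ofReal)
      (ENNReal.ofReal (t ^ p)))
    rw [mul_comm]
    gcongr with y
    intro hy
    exact ENNReal.ofReal_le_ofReal (Real.rpow_le_rpow ht.le (le_of_lt hy) hp.le)
  have hkey : ∀ t : ℝ, 0 < t → μ {x | t < F x} * ENNReal.ofReal (t ^ (α * p - 1)) ≤
      C * J ^ (α - 1) * (ν {y | t < h y} * ENNReal.ofReal (t ^ (p - 1))) := by
    intro t ht
    have h1 : ENNReal.ofReal (t ^ (α * p - 1)) =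
        ENNReal.ofReal (t ^ p) ^ (α - 1) * ENNReal.ofReal (t ^ (p - 1)) := by
      rw [ENNReal.ofReal_rpow_of_nonneg (by positivity) (by linarith),
        ← ENNReal.ofReal_mul (by positivity), ← Real.rpow_mul ht.le, ← Real.rpow_add ht]
      congr 2; ring
    calc _ ≤ C * (ν {y | t < h y} * ν {y | t < h y} ^ (α - 1)) *
          (ENNReal.ofReal (t ^ p) ^ (α - 1) * ENNReal.ofReal (t ^ (p - 1))) := by
          rw [h1, ← hpow]
          gcongr
          exact H t ht
      _ = C * (ν {y | t < h y} * ENNReal.ofReal (t ^ p)) ^ (α - 1) *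
          (ν {y | t < h y} * ENNReal.ofReal (t ^ (p - 1))) := by
          rw [ENNReal.mul_rpow_of_nonneg _ _ (by linarith)]
          ring
      _ ≤ _ := by
          gcongr
          exact hcheb t ht
  have hJ1 : C * J ^ (α - 1) ≠ ⊤ :=
    ENNReal.mul_ne_top hC (ENNReal.rpow_ne_top_of_nonneg (by linarith) hJ)
  calc ∫⁻ x, ENNReal.ofReal (F x ^ (α * p)) ∂μ
      = ENNReal.ofReal (α * p) *
          ∫⁻ t in Ioi (0 : ℝ), μ {x | t < F x} * ENNReal.ofReal (t ^ (α * p - 1)) :=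
        lintegral_rpow_eq_lintegral_meas_lt_mul μ (Eventually.of_forall hF0) hF (by positivity)
    _ ≤ ENNReal.ofReal (α * p) * ∫⁻ t in Ioi (0 : ℝ),
          C * J ^ (α - 1) * (ν {y | t < h y} * ENNReal.ofReal (t ^ (p - 1))) := by
        refine mul_le_mul_right ?_ _
        exact setLIntegral_mono' measurableSet_Ioi fun t ht => hkey t ht
    _ = C * ENNReal.ofReal α * (J ^ (α - 1) * (ENNReal.ofReal p *
          ∫⁻ t in Ioi (0 : ℝ), ν {y | t < h y} * ENNReal.ofReal (t ^ (p - 1)))) := by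
        rw [lintegral_const_mul' _ _ hJ1, ENNReal.ofReal_mul hα0.le]
        ring
    _ = C * ENNReal.ofReal α * J ^ α := by
        rw [← lintegral_rpow_eq_lintegral_meas_lt_mul ν (Eventually.of_forall hh0) hh hp, ← hJdef,
          hpow J, mul_comm J]

theorem aemeasurable_ntLimit {n : ℕ} (hn : 2 ≤ n) {κ : ℝ} (hκ : 0 < κ) {f g : Vec n → Vec n}
    (hf : ContinuousOn f (unitBall n))
    (hg : ∀ᵐ ω ∂(sphMeasure n), HasNTLimit n κ f ω (g ω)) :
    AEMeasurable (fun ω : sphere (0 : Vec n) 1 => g ω) (coneMeasure n) := by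
  set r : ℕ → ℝ := fun k => 1 - 1 / ((k : ℝ) + 1) with hr
  have hr0 : ∀ k, 0 ≤ r k ∧ r k < 1 := by
    intro k
    have h1 : (0 : ℝ) < (k : ℝ) + 1 := by positivity
    have h2 : 1 / ((k : ℝ) + 1) ≤ 1 := by
      rw [div_le_one h1]
      linarith [(Nat.cast_nonneg k : (0 : ℝ) ≤ k)]
    have h3 : 0 < 1 / ((k : ℝ) + 1) := by positivity
    constructor <;> simp only [hr] <;> linarith
  have hrt : Tendsto r atTop (𝓝[<] 1) := by
    refine tendsto_nhdsWithin_iff.2 ⟨?_, Eventually.of_forall fun k => (hr0 k).2⟩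
    simpa [hr] using (tendsto_const_nhds (x := (1 : ℝ))).sub tendsto_one_div_add_atTop_nhds_zero_nat
  refine aemeasurable_of_tendsto_metrizable_ae (f := fun k (ω : sphere (0 : Vec n) 1) =>
    f (r k • (ω : Vec n))) atTop (fun k => ?_) ?_
  · have : Continuous fun ω : sphere (0 : Vec n) 1 => f (r k • (ω : Vec n)) := by
      refine hf.comp_continuous (by fun_prop) fun ω => ?_
      have hω : ‖(ω : Vec n)‖ = 1 := by simp
      simpa [unitBall, norm_smul, hω, abs_of_nonneg (hr0 k).1] using (hr0 k).2
    exact this.measurable.aemeasurable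
  · filter_upwards [ae_coneMeasure_of_ae_sphMeasure hn hg] with ω hω
    exact (hω.tendsto_radial hκ (by simp)).comp hrt

theorem carleson_integral_estimate (n : ℕ) (hn : 2 ≤ n) (K C₀ α₀ a C₁ κ p αc γ : ℝ)
    (hK : 1 ≤ K) (hC₀ : 1 ≤ C₀) (hα₀ : 0 < α₀) (ha0 : 0 ≤ a) (ha : a < (n : ℝ) - 1)
    (hC₁ : 0 < C₁) (hκ : 0 < κ) (hp : 0 < p) (hαc : 1 ≤ αc) (hγ : 0 < γ) :
    ∃ C : ℝ, 0 < C ∧ ∀ μ : Measure (Vec n), IsAlphaCarleson n αc γ μ →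
      ∀ f : Vec n → Vec n,
        IsQR n K f → (∀ x ∈ unitBall n, f x ≠ 0) →
        InMiniowitz n C₀ α₀ f → MultCond n a C₁ f →
        ∀ g : Vec n → Vec n, (∀ᵐ ω ∂(sphMeasure n), HasNTLimit n κ f ω (g ω)) →
          ∫⁻ x in unitBall n, ENNReal.ofReal (‖f x‖ ^ (αc * p)) ∂μ ≤
            ENNReal.ofReal C *
              (∫⁻ ω, ENNReal.ofReal (‖g ω‖ ^ p) ∂(sphMeasure n)) ^ αc := by
  obtain ⟨c, hc, C, hC, hlev⟩ := exists_measure_superlevel_le (γ := γ) hn hK hC₀ hα₀ ha0 ha hC₁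
    hκ hαc
  obtain ⟨Cσ, hCσ⟩ := exists_map_coneMeasure_le hn
  have hαc0 : 0 < αc := by linarith
  set B : ℝ≥0∞ := ENNReal.ofReal ((c ^ p)⁻¹) * Cσ with hB
  have hBtop : B ≠ ⊤ := ENNReal.mul_ne_top ENNReal.ofReal_ne_top ENNReal.coe_ne_top
  set Q : ℝ≥0∞ := C * ENNReal.ofReal αc * B ^ αc with hQ
  have hQtop : Q ≠ ⊤ := ENNReal.mul_ne_top (ENNReal.mul_ne_top hC ENNReal.ofReal_ne_top)
    (ENNReal.rpow_ne_top_of_nonneg hαc0.le hBtop)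
  have hQle : Q ≤ ENNReal.ofReal (Q.toReal + 1) := by
    rw [ENNReal.le_ofReal_iff_toReal_le hQtop (by positivity)]
    linarith
  refine ⟨Q.toReal + 1, by positivity, fun μ hμ f hQR h0 hMin hM g hg => ?_⟩
  set I := ∫⁻ ω, ENNReal.ofReal (‖g ω‖ ^ p) ∂(sphMeasure n) with hI
  set J := ∫⁻ ω : sphere (0 : Vec n) 1, ENNReal.ofReal ((‖g ω‖ / c) ^ p) ∂(coneMeasure n) with hJ
  have hJI : J ≤ B * I := by
    have h1 : J = ENNReal.ofReal ((c ^ p)⁻¹) *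
        ∫⁻ ω : sphere (0 : Vec n) 1, ENNReal.ofReal (‖g ω‖ ^ p) ∂(coneMeasure n) := by
      rw [← lintegral_const_mul' _ _ ENNReal.ofReal_ne_top, hJ]
      congr 1; ext ω
      rw [← ENNReal.ofReal_mul (by positivity), Real.div_rpow (norm_nonneg _) hc.le]
      congr 1; ring
    rw [h1, hB, mul_assoc]
    gcongr
    rw [← (MeasurableEmbedding.subtype_coe (isClosed_sphere.measurableSet)).lintegral_map
      (fun ω : Vec n => ENNReal.ofReal (‖g ω‖ ^ p))]
    refine (lintegral_mono' hCσ le_rfl).trans (le_of_eq ?_)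
    rw [lintegral_smul_measure]
    rfl
  rcases eq_or_ne I ⊤ with hItop | hItop
  · rw [hItop, ENNReal.top_rpow_of_pos hαc0, ENNReal.mul_top]
    · exact le_top
    · rw [ENNReal.ofReal_ne_zero_iff]; positivity
  have hJtop : J ≠ ⊤ := ne_top_of_le_ne_top (ENNReal.mul_ne_top hBtop hItop) hJI
  have hBm : MeasurableSet (unitBall n) := measurableSet_ball
  have hmain := lintegral_rpow_le_of_measure_lt_le (μ := μ.restrict (unitBall n))
    (ν := coneMeasure n) (F := fun x => ‖f x‖)
    (h := fun ω : sphere (0 : Vec n) 1 => ‖g ω‖ / c) (fun x => norm_nonneg _)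
    (fun ω => by positivity) (hQR.1.aemeasurable hBm).norm
    ((aemeasurable_ntLimit hn hκ hQR.1 hg).norm.div_const c) hp hαc hC ?_ hJtop
  · refine hmain.trans ?_
    calc C * ENNReal.ofReal αc * J ^ αc ≤ C * ENNReal.ofReal αc * (B * I) ^ αc := by gcongr
      _ = Q * I ^ αc := by
          rw [ENNReal.mul_rpow_of_nonneg _ _ hαc0.le, hQ]
          ring
      _ ≤ _ := by gcongr
  · intro t _
    rw [Measure.restrict_apply' hBm]
    refine le_trans (measure_mono ?_) (hlev μ hμ f hQR h0 hMin hM g hg t)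
    exact fun x hx => ⟨hx.2, hx.1⟩

end
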